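/- (Rate of convergence in Wasserstein distance) Fix an integer k ≥ 3. For each N ≥ 3, let M be distributed according to the uni-modular ensemble of dimension N, W = M/(2√(N−2)), F(M) = (F_3(M), …, F_k(M)) with F_n(M) = Tr[T_n(W)] − ⟨Tr[T_n(W)]⟩, and let Z = (Z_3, …, Z_k) be a vector of independent centered Gaussian random variables with variance ⟨Z_n²⟩ = n/4. Then the Wasserstein distance between F(M) and Z satisfies d_W(F(M), Z) = O(N^{−1/2}); i.e. there exist constants C and N₀ (depending only on k) such that for all N ≥ N₀ and every Lipschitz function f : ℝ^{k−2} → ℝ with Lipschitz constant at most 1 (with respect to the Euclidean norm), |⟨f(F(M))⟩ − ⟨f(Z)⟩| ≤ C N^{−1/2}. -/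

import Mathlib

open MeasureTheory Matrix

noncomputable section

/-- The uniform probability measure on `[0, 2π)`. -/
def uniformPhase : Measure ℝ :=
  (ENNReal.ofReal (2 * Real.pi))⁻¹ • volume.restrict (Set.Ico 0 (2 * Real.pi))

/-- Product measure: the phases `ω μ ν` (used for `μ < ν`) are i.i.d. uniform on `[0, 2π)`. -/
def phaseMeasure (N : ℕ) : Measure (Fin N → Fin N → ℝ) :=
  Measure.pi fun _ => Measure.pi fun _ => uniformPhase

/-- Antisymmetrized phases built from a raw sample: `φ ν μ = - φ μ ν`, `φ μ μ = 0`. -/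
def phases (N : ℕ) (ω : Fin N → Fin N → ℝ) : Fin N → Fin N → ℝ :=
  fun μ ν => if μ < ν then ω μ ν else if ν < μ then - (ω ν μ) else 0

/-- The uni-modular matrix with phases `φ`: zero diagonal, `M μ ν = exp(i φ μ ν)` off diagonal. -/
def umeMatrix (N : ℕ) (φ : Fin N → Fin N → ℝ) : Matrix (Fin N) (Fin N) ℂ :=
  fun μ ν => if μ = ν then 0 else Complex.exp (Complex.I * (φ μ ν : ℂ))


/-- The scaled UME matrix `W = M / (2√(N−2))`. -/
def scaledUme (N : ℕ) (φ : Fin N → Fin N → ℝ) : Matrix (Fin N) (Fin N) ℂ :=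
  ((1 / (2 * Real.sqrt ((N : ℝ) - 2)) : ℝ) : ℂ) • umeMatrix N φ

/-- `Tr[T_n(W)]`, the trace of the `n`-th Chebyshev polynomial of the first kind evaluated
at the scaled UME matrix `W = M/(2√(N−2))`. -/
def chebTrace (N : ℕ) (φ : Fin N → Fin N → ℝ) (n : ℕ) : ℂ :=
  Matrix.trace (Polynomial.aeval (scaledUme N φ) (Polynomial.Chebyshev.T ℂ n))

open scoped NNReal

/-- The centered trace `F_n(M) = Tr[T_n(W)] − ⟨Tr[T_n(W)]⟩` (a real number, since the trace
of a real polynomial of a Hermitian matrix is real), as a function of the phase sample. -/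
def centeredChebTrace (N : ℕ) (n : ℕ) (ω : Fin N → Fin N → ℝ) : ℝ :=
  (chebTrace N (phases N ω) n
    - ∫ ω', chebTrace N (phases N ω') n ∂(phaseMeasure N)).re

/-- The distribution of `Z = (Z_3, …, Z_k)`: independent centered Gaussians,
`Z_n` of variance `n/4`, with coordinate `i : Fin (k-2)` corresponding to `n = i + 3`. -/
def gaussLimit (k : ℕ) : Measure (Fin (k - 2) → ℝ) :=
  Measure.pi fun i => ProbabilityTheory.gaussianReal 0 ((((i : ℕ) : ℝ≥0) + 3) / 4)

section
/-! ### Part 1: combinatorics of closed walks -/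

/-- Signed edge flow of a configuration `x` of positions moved by the permutation `σ`. -/
def edgeFlow {P V : Type*} [Fintype P] [DecidableEq V] (σ : Equiv.Perm P) (ε : P → ℤ)
    (x : P → V) (a b : V) : ℤ :=
  ∑ p, ε p * ((if x p = a ∧ x (σ p) = b then 1 else 0) - (if x p = b ∧ x (σ p) = a then 1 else 0))

lemma edgeFlow_eq {P V : Type*} [Fintype P] [DecidableEq V] (σ : Equiv.Perm P) (ε : P → ℤ)
    (hε : ∀ p, ε (σ p) = ε p) (x : P → V) (a b : V) :
    edgeFlow σ ε x a b = ∑ q, if x q = a then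
      ε q * ((if x (σ q) = b then 1 else 0) - (if x (σ.symm q) = b then 1 else 0)) else 0 := by
  have h2 : ∑ p, ε p * (if x p = b ∧ x (σ p) = a then (1 : ℤ) else 0)
      = ∑ q, ε q * (if x (σ.symm q) = b ∧ x q = a then (1 : ℤ) else 0) := by
    rw [← Equiv.sum_comp σ (fun q => ε q * (if x (σ.symm q) = b ∧ x q = a then (1 : ℤ) else 0))]
    apply Finset.sum_congr rfl
    intro p _
    simp [hε]
  unfold edgeFlow
  simp only [mul_sub, Finset.sum_sub_distrib]
  rw [h2, ← Finset.sum_sub_distrib]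
  apply Finset.sum_congr rfl
  intro q _
  by_cases h : x q = a <;> simp [h]

section U
variable {P V : Type*} [Fintype P] [DecidableEq V] (σ : Equiv.Perm P) (ε : P → ℤ)
    (x : P → V)

lemma visit_twice (hε : ∀ p, ε (σ p) = ε p) (hε1 : ∀ p, ε p = 1 ∨ ε p = -1)
    (hnb : ∀ p, x (σ (σ p)) ≠ x p) (h0 : ∀ a b, edgeFlow σ ε x a b = 0) (p : P) :
    ∃ p', p' ≠ p ∧ x p' = x p := by
  classical
  by_contra hcon
  push Not at hcon
  have h := h0 (x p) (x (σ p))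
  rw [edgeFlow_eq σ ε hε, Finset.sum_eq_single p] at h
  · have h3 : x (σ.symm p) ≠ x (σ p) := by
      have := hnb (σ.symm p)
      simp at this
      exact Ne.symm this
    rcases hε1 p with h4 | h4 <;> simp [h3, h4] at h
  · intro q _ hq
    simp [hcon q hq]
  · simp

lemma visit_pair (hε : ∀ p, ε (σ p) = ε p) (hε1 : ∀ p, ε p = 1 ∨ ε p = -1)
    (hnb : ∀ p, x (σ (σ p)) ≠ x p) (h0 : ∀ a b, edgeFlow σ ε x a b = 0) (p p' : P)
    (hpp : p ≠ p') (hx : x p = x p') (hf : ∀ q, x q = x p → q = p ∨ q = p') :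
    (ε p = ε p' → x (σ p) = x (σ.symm p')) ∧ (ε p ≠ ε p' → x (σ p) = x (σ p')) := by
  classical
  have h := h0 (x p) (x (σ p))
  rw [edgeFlow_eq σ ε hε, ← Finset.sum_subset (Finset.subset_univ {p, p'}),
    Finset.sum_pair hpp] at h
  · have h3 : x (σ.symm p) ≠ x (σ p) := by
      have := hnb (σ.symm p)
      simp at this
      exact Ne.symm this
    have h3' : x (σ.symm p') ≠ x (σ p') := by
      have := hnb (σ.symm p')
      simp at this
      exact Ne.symm this
    constructor
    · intro he
      by_contra hne
      rcases hε1 p with h4 | h4 <;> rw [← he] at h <;>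
        by_cases h5 : x (σ p') = x (σ p) <;> simp [h3, h4, h5, hx.symm, Ne.symm hne] at h
    · intro he
      by_contra hne
      rcases hε1 p with h4 | h4 <;> rcases hε1 p' with h6 | h6 <;> first
        | (exact he (h4.trans h6.symm))
        | (by_cases h5 : x (σ.symm p') = x (σ p) <;>
            simp [h3, h4, h5, h6, hx.symm, Ne.symm hne] at h)
  · intro q _ hq
    rw [if_neg]
    intro hq'
    rcases hf q hq' with h | h <;> simp [h] at hq

/-- If every value is taken at least twice and there are more than `r - 1` values among `2 r`
positions then no value is taken three times. -/
lemma no_three {r : ℕ} (hP : Fintype.card P = 2 * r)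
    (h2 : ∀ p, ∃ p', p' ≠ p ∧ x p' = x p) (hr : r ≤ (Finset.univ.image x).card)
    (p p' q : P) (hpp : p ≠ p') (h : x p = x p') (hq : x q = x p) : q = p ∨ q = p' := by
  classical
  by_contra hcon
  push Not at hcon
  have hsum : ∑ v ∈ Finset.univ.image x, (Finset.univ.filter (fun q => x q = v)).card = 2 * r := by
    rw [← hP, ← Finset.card_univ]
    exact (Finset.card_eq_sum_card_fiberwise (fun q _ => by simp)).symm
  have hlt : ∑ v ∈ Finset.univ.image x, 2
      < ∑ v ∈ Finset.univ.image x, (Finset.univ.filter (fun q => x q = v)).card := by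
    apply Finset.sum_lt_sum
    · intro v hv
      obtain ⟨p1, _, rfl⟩ := Finset.mem_image.1 hv
      obtain ⟨p2, h3, h4⟩ := h2 p1
      rw [← Finset.card_pair h3.symm]
      apply Finset.card_le_card
      intro q hq
      simp at hq
      rcases hq with rfl | rfl <;> simp [h4]
    · refine ⟨x p, by simp, ?_⟩
      have : ({q, p, p'} : Finset P).card = 3 := by
        rw [Finset.card_insert_of_notMem (by simp [hcon.1, hcon.2]), Finset.card_pair hpp]
      have h3 : ({q, p, p'} : Finset P).card ≤
          (Finset.univ.filter (fun q => x q = x p)).card := by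
        apply Finset.card_le_card
        intro s hs
        simp at hs
        rcases hs with rfl | rfl | rfl <;> simp [hq, h]
      omega
  rw [hsum] at hlt
  simp at hlt
  omega
end U

/-- Number of configurations with few distinct values. -/
lemma card_few_values (P : Type*) [Fintype P] [DecidableEq P] [hP : Nonempty P] (N r : ℕ) (S : Finset (P → Fin N))
    (hS : ∀ x ∈ S, (Finset.univ.image x).card ≤ r) :
    S.card ≤ r ^ Fintype.card P * N ^ r := by
  classical
  have : S ⊆ (Finset.univ : Finset ((P → Fin r) × (Fin r → Fin N))).image
      (fun gh => gh.2 ∘ gh.1) := by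
    intro x hx
    have h := hS x hx
    simp only [Finset.mem_image, Finset.mem_univ, true_and, Prod.exists]
    obtain ⟨p0⟩ := hP
    let e := (Finset.univ.image x).equivFin
    refine ⟨fun p => Fin.castLE h (e ⟨x p, by simp⟩), fun t =>
      if ht : t.1 < (Finset.univ.image x).card then (e.symm ⟨t.1, ht⟩).1 else x p0, ?_⟩
    ext p
    simp
  calc S.card ≤ _ := Finset.card_le_card this
    _ ≤ _ := Finset.card_image_le
    _ = _ := by simp
end

section
/-! ### Part 2: flows of closed walks -/

/-- Net number of traversals of the directed edge `(a, b)` by the closed walk `w`. -/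
def wflow {V : Type*} [DecidableEq V] {n : ℕ} [NeZero n] (w : ZMod n → V) (a b : V) : ℤ :=
  ∑ i, ((if w i = a ∧ w (i + 1) = b then 1 else 0) - (if w i = b ∧ w (i + 1) = a then 1 else 0))

/-- Cyclically non-backtracking closed walks. -/
def IsCnb {V : Type*} {n : ℕ} (w : ZMod n → V) : Prop :=
  ∀ i, w i ≠ w (i + 1) ∧ w i ≠ w (i + 2)

section
variable {V : Type*} [DecidableEq V] {n m : ℕ} [NeZero n] [NeZero m]

lemma wflow_antisymm (w : ZMod n → V) (a b : V) : wflow w b a = - wflow w a b := by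
  unfold wflow
  rw [← Finset.sum_neg_distrib]
  apply Finset.sum_congr rfl
  intros; ring

lemma exists_of_wflow_ne (w : ZMod n → V) (a b : V) (h : wflow w a b ≠ 0) : ∃ i, w i = a := by
  by_contra hcon
  push Not at hcon
  apply h
  unfold wflow
  apply Finset.sum_eq_zero
  intro i _
  simp [hcon i, hcon (i + 1)]

lemma exists_of_wflow_pos (w : ZMod n → V) (a b : V) (h : 0 < wflow w a b) :
    ∃ i, w i = a ∧ w (i + 1) = b := by
  by_contra hcon
  push Not at hcon
  apply absurd h
  unfold wflow
  push Not
  apply Finset.sum_nonpos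
  intro i _
  have : ¬ (w i = a ∧ w (i + 1) = b) := fun h => hcon i h.1 h.2
  rw [if_neg this]
  split_ifs <;> simp

lemma abs_wflow_le (w : ZMod n → V) (a b : V) : |wflow w a b| ≤ n := by
  unfold wflow
  refine (Finset.abs_sum_le_sum_abs _ _).trans ?_
  calc _ ≤ ∑ i : ZMod n, (1 : ℤ) := by
        apply Finset.sum_le_sum
        intro i _
        split_ifs <;> simp
    _ = n := by simp [ZMod.card]

lemma isCnb_of_injective (hn : 3 ≤ n) (w : ZMod n → V) (hw : Function.Injective w) : IsCnb w := by
  have h1 : (1 : ZMod n) ≠ 0 := by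
    intro h
    have := (ZMod.natCast_eq_zero_iff 1 n).1 (by exact_mod_cast h)
    have := Nat.le_of_dvd (by norm_num) this
    omega
  have h2 : (2 : ZMod n) ≠ 0 := by
    intro h
    have := (ZMod.natCast_eq_zero_iff 2 n).1 (by exact_mod_cast h)
    have := Nat.le_of_dvd (by norm_num) this
    omega
  intro i
  constructor
  · intro h; have := hw h; simp [h1] at this
  · intro h; have := hw h; simp [h2] at this

lemma wflow_own_edge (hn : 3 ≤ n) (w : ZMod n → V) (hw : Function.Injective w) (i : ZMod n) :
    wflow w (w i) (w (i + 1)) = 1 := by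
  unfold wflow
  rw [Finset.sum_eq_single i]
  · have := (isCnb_of_injective hn w hw i).1
    simp [this]
  · intro j _ hj
    have h1 : w j ≠ w i := fun h => hj (hw h)
    have h2 : ¬ (w j = w (i + 1) ∧ w (j + 1) = w i) := by
      rintro ⟨h, h'⟩
      rw [hw h] at h'
      apply (isCnb_of_injective hn w hw i).2
      rw [← h']
      congr 1; ring
    simp [h1, h2]
  · simp

/-- Summation by parts for flows. -/
lemma sum_wflow_mul [Fintype V] {R : Type*} [CommRing R] (w : ZMod n → V) (g : V → V → R) :
    ∑ a, ∑ b, (wflow w a b : R) * g a b = ∑ i, (g (w i) (w (i + 1)) - g (w (i + 1)) (w i)) := by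
  have : ∀ a b, (wflow w a b : R) * g a b = ∑ i, ((if w i = a then (if w (i + 1) = b then g a b else 0) else 0)
      - (if w (i + 1) = a then (if w i = b then g a b else 0) else 0)) := by
    intro a b
    unfold wflow
    push_cast
    rw [Finset.sum_mul]
    apply Finset.sum_congr rfl
    intro i _
    simp only [sub_mul, ite_mul, one_mul, zero_mul, ite_and, Int.cast_ite, Int.cast_one, Int.cast_zero]
    congr 1
    split_ifs <;> rfl
  simp_rw [this]
  have e : ∀ a, ∑ b, ∑ i, ((if w i = a then (if w (i + 1) = b then g a b else 0) else 0)
      - (if w (i + 1) = a then (if w i = b then g a b else 0) else 0))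
      = ∑ i, ∑ b, ((if w i = a then (if w (i + 1) = b then g a b else 0) else 0)
      - (if w (i + 1) = a then (if w i = b then g a b else 0) else 0)) :=
    fun a => Finset.sum_comm
  simp_rw [e]
  rw [Finset.sum_comm]
  apply Finset.sum_congr rfl
  intro i _
  simp only [Finset.sum_sub_distrib]
  congr 1
  · rw [Finset.sum_eq_single (w i)] <;> simp +contextual [eq_comm]
  · rw [Finset.sum_eq_single (w (i + 1))] <;> simp +contextual [eq_comm]

/-- If two injective closed walks follow each other, they have the same length. -/
lemma follow_len (w : ZMod n → V) (w' : ZMod m → V) (hw : Function.Injective w)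
    (hw' : Function.Injective w') (i : ZMod n) (i' : ZMod m)
    (h : ∀ t : ℕ, w (i + t) = w' (i' + t)) : n = m := by
  apply Nat.dvd_antisymm
  · have h1 := h m
    simp only [CharP.cast_eq_zero, add_zero] at h1
    have h2 := h 0
    simp only [Nat.cast_zero, add_zero] at h2
    have := hw (h1.trans h2.symm)
    simp at this
    exact (ZMod.natCast_eq_zero_iff _ _).1 this
  · have h1 := h n
    simp only [CharP.cast_eq_zero, add_zero] at h1
    have h2 := h 0
    simp only [Nat.cast_zero, add_zero] at h2
    have := hw' (h1.symm.trans h2)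
    simp at this
    exact (ZMod.natCast_eq_zero_iff _ _).1 this

lemma follow_rot (w w' : ZMod n → V) (i i' : ZMod n)
    (h : ∀ t : ℕ, w (i + t) = w' (i' + t)) : w' = fun j => w (j + (i - i')) := by
  ext j
  have := h (j - i').val
  simp only [ZMod.natCast_val, ZMod.cast_id', id_eq] at this
  rw [show i' + (j - i') = j by ring] at this
  rw [← this]
  congr 1; ring

lemma wflow_rot (w : ZMod n → V) (r : ZMod n) : wflow (fun j => w (j + r)) = wflow w := by
  ext a b
  unfold wflow
  refine Fintype.sum_equiv (Equiv.addRight r) _ _ (fun j => ?_)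
  have e : j + 1 + r = j + r + 1 := by ring
  simp only [Equiv.coe_addRight, e]
  rfl

lemma wflow_neg (w : ZMod n → V) : wflow (fun j => w (-j)) = fun a b => - wflow w a b := by
  ext a b
  rw [← wflow_antisymm]
  unfold wflow
  rw [← Equiv.sum_comp ((Equiv.neg (ZMod n)).trans (Equiv.subRight 1))]
  apply Finset.sum_congr rfl
  intro j _
  simp only [Equiv.trans_apply, Equiv.neg_apply, Equiv.subRight_apply]
  simp only [neg_sub, sub_neg_eq_add, sub_add_cancel, neg_neg]
  simp only [add_comm 1 j, and_comm]

lemma follow_of_wflow_eq (hn : 3 ≤ n) (w : ZMod n → V) (w' : ZMod m → V)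
    (hw : Function.Injective w)
    (hw' : Function.Injective w') (h : wflow w = wflow w') :
    ∃ (i : ZMod n) (i' : ZMod m), ∀ t : ℕ, w (i + t) = w' (i' + t) := by
  have key : ∀ i, ∃ i', w' i' = w i ∧ w' (i' + 1) = w (i + 1) := by
    intro i
    apply exists_of_wflow_pos
    rw [← h, wflow_own_edge hn w hw]; norm_num
  obtain ⟨i', h1, h2⟩ := key 0
  refine ⟨0, i', fun t => ?_⟩
  induction t with
  | zero => simp [h1]
  | succ t ih =>
    obtain ⟨j, h3, h4⟩ := key (0 + t)
    have : j = i' + t := hw' (h3.trans ih)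
    subst this
    push_cast
    rw [← add_assoc, ← add_assoc, h4]

/-- Pairs of closed walks with equal flow, the first being non-simple. -/
lemma pair_count (hn : 3 ≤ n) (w w' : ZMod n → V) (hw : IsCnb w) (hw' : IsCnb w')
    (hni : ¬ Function.Injective w) (h : wflow w = wflow w') :
    (Finset.univ.image (Sum.elim w w')).card ≤ n - 1 := by
  by_contra hcon
  let σ : Equiv.Perm (ZMod n ⊕ ZMod n) := Equiv.sumCongr (Equiv.addRight 1) (Equiv.addRight 1)
  let ε : ZMod n ⊕ ZMod n → ℤ := Sum.elim (fun _ => 1) (fun _ => -1)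
  have hε : ∀ p, ε (σ p) = ε p := by rintro (p | p) <;> rfl
  have hε1 : ∀ p, ε p = 1 ∨ ε p = -1 := by rintro (p | p) <;> simp [ε]
  have hnb : ∀ p, Sum.elim w w' (σ (σ p)) ≠ Sum.elim w w' p := by
    rintro (p | p)
    · have := (hw p).2
      simp only [σ, Equiv.sumCongr_apply, Sum.map_inl, Sum.elim_inl, Equiv.coe_addRight, ne_eq, add_assoc]
      rw [one_add_one_eq_two]; exact Ne.symm this
    · have := (hw' p).2
      simp only [σ, Equiv.sumCongr_apply, Sum.map_inr, Sum.elim_inr, Equiv.coe_addRight, ne_eq, add_assoc]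
      rw [one_add_one_eq_two]; exact Ne.symm this
  have h0 : ∀ a b, edgeFlow σ ε (Sum.elim w w') a b = 0 := by
    intro a b
    have := congrFun (congrFun h a) b
    unfold wflow at this
    unfold edgeFlow
    rw [Fintype.sum_sum_type]
    simp only [σ, ε, Sum.elim_inl, Sum.elim_inr, Equiv.sumCongr_apply, Sum.map_inl, Sum.map_inr,
      Equiv.coe_addRight, one_mul, neg_mul]
    rw [this, Finset.sum_neg_distrib]
    ring
  have h3 := no_three (r := n) (Sum.elim w w') (by simp [ZMod.card]; ring)
    (visit_twice σ ε _ hε hε1 hnb h0) (by omega)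
  have h4 : ∀ i j, i ≠ j → w i = w j → w (i + 1) = w (j - 1) := by
    intro i j hij hwij
    have := (visit_pair σ ε (Sum.elim w w') hε hε1 hnb h0 (Sum.inl i) (Sum.inl j) (by simpa using hij)
      (by simpa using hwij) (fun q hq => h3 _ _ q (by simpa using hij) (by simpa using hwij) hq)).1 rfl
    simpa [σ, sub_eq_add_neg] using this
  unfold Function.Injective at hni
  push Not at hni
  obtain ⟨i, j, hij, hne⟩ := hni
  have h5 : ∀ t : ℕ, i + t ≠ j - t ∧ w (i + t) = w (j - t) := by
    intro t
    induction t with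
    | zero => simp [hij, hne]
    | succ t ih =>
      have h6 := h4 _ _ ih.1 ih.2
      push_cast
      rw [← add_assoc, ← sub_sub]
      refine ⟨?_, h6⟩
      intro h7
      apply (hw (i + t)).2
      rw [ih.2, show i + (t : ZMod n) + 2 = (i + t + 1) + 1 by ring, h7]
      congr 1; ring
  have hl : j = i + ((j - i).val : ℕ) := by
    simp
  rcases Nat.even_or_odd' (j - i).val with ⟨t, ht | ht⟩
  · apply (h5 t).1
    rw [ht] at hl
    rw [hl]; push_cast; ring
  · apply (hw (i + t)).1
    rw [(h5 t).2]
    rw [ht] at hl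
    rw [hl]; push_cast
    congr 1; ring

/-- Quadruples of simple closed walks. -/
lemma quad_count (hn : 3 ≤ n) (hm : 3 ≤ m) (w w2 : ZMod n → V) (w' w2' : ZMod m → V)
    (hw : Function.Injective w) (hw' : Function.Injective w')
    (hw2 : Function.Injective w2) (hw2' : Function.Injective w2')
    (hmeet : ∃ i i', w i = w' i') (hne : wflow w ≠ wflow w')
    (h : ∀ a b, wflow w a b - wflow w' a b = wflow w2 a b - wflow w2' a b) :
    (Finset.univ.image (Sum.elim (Sum.elim w w') (Sum.elim w2 w2'))).card ≤ n + m - 1 := by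
  by_contra hcon
  let σ : Equiv.Perm ((ZMod n ⊕ ZMod m) ⊕ (ZMod n ⊕ ZMod m)) :=
    Equiv.sumCongr (Equiv.sumCongr (Equiv.addRight 1) (Equiv.addRight 1))
      (Equiv.sumCongr (Equiv.addRight 1) (Equiv.addRight 1))
  let ε : (ZMod n ⊕ ZMod m) ⊕ (ZMod n ⊕ ZMod m) → ℤ :=
    Sum.elim (Sum.elim (fun _ => 1) (fun _ => -1)) (Sum.elim (fun _ => -1) (fun _ => 1))
  let x := Sum.elim (Sum.elim w w') (Sum.elim w2 w2')
  have hε : ∀ p, ε (σ p) = ε p := by rintro ((p | p) | (p | p)) <;> rfl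
  have hε1 : ∀ p, ε p = 1 ∨ ε p = -1 := by rintro ((p | p) | (p | p)) <;> simp [ε]
  have hnb : ∀ p, x (σ (σ p)) ≠ x p := by
    rintro ((p | p) | (p | p))
    · have := (isCnb_of_injective hn _ hw p).2
      simp only [x, σ, Equiv.sumCongr_apply, Sum.map_inl, Sum.elim_inl, Equiv.coe_addRight, ne_eq, add_assoc]
      rw [one_add_one_eq_two]; exact Ne.symm this
    · have := (isCnb_of_injective hm _ hw' p).2
      simp only [x, σ, Equiv.sumCongr_apply, Sum.map_inl, Sum.elim_inl, Sum.map_inr, Sum.elim_inr, Equiv.coe_addRight, ne_eq, add_assoc]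
      rw [one_add_one_eq_two]; exact Ne.symm this
    · have := (isCnb_of_injective hn _ hw2 p).2
      simp only [x, σ, Equiv.sumCongr_apply, Sum.map_inl, Sum.elim_inl, Sum.map_inr, Sum.elim_inr, Equiv.coe_addRight, ne_eq, add_assoc]
      rw [one_add_one_eq_two]; exact Ne.symm this
    · have := (isCnb_of_injective hm _ hw2' p).2
      simp only [x, σ, Equiv.sumCongr_apply, Sum.map_inl, Sum.elim_inl, Sum.map_inr, Sum.elim_inr, Equiv.coe_addRight, ne_eq, add_assoc]
      rw [one_add_one_eq_two]; exact Ne.symm this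
  have h0 : ∀ a b, edgeFlow σ ε x a b = 0 := by
    intro a b
    have := h a b
    unfold wflow at this
    unfold edgeFlow
    simp only [Fintype.sum_sum_type]
    simp only [x, σ, ε, Sum.elim_inl, Sum.elim_inr, Equiv.sumCongr_apply, Sum.map_inl, Sum.map_inr,
      Equiv.coe_addRight, one_mul, neg_mul, Finset.sum_neg_distrib]
    linarith
  have h3 := no_three (r := n + m) x (by simp [ZMod.card]; ring)
    (visit_twice σ ε _ hε hε1 hnb h0) (by change ¬ ((Finset.univ.image x).card ≤ _) at hcon; omega)
  have h4 : ∀ i j, w i = w' j → w (i + 1) = w' (j + 1) := by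
    intro i j hwij
    have := (visit_pair σ ε x hε hε1 hnb h0 (Sum.inl (Sum.inl i)) (Sum.inl (Sum.inr j)) (by simp)
      (by simpa [x] using hwij) (fun q hq => h3 _ _ q (by simp) (by simpa [x] using hwij) hq)).2
      (by simp [ε])
    simpa [σ, x] using this
  obtain ⟨i, i', hii⟩ := hmeet
  have h5 : ∀ t : ℕ, w (i + t) = w' (i' + t) := by
    intro t
    induction t with
    | zero => simpa using hii
    | succ t ih =>
      have h6 := h4 _ _ ih
      push_cast
      rw [← add_assoc, ← add_assoc, h6]
  have hnm := follow_len w w' hw hw' i i' h5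
  subst hnm
  apply hne
  have := follow_rot w w' i i' h5
  conv_rhs => rw [this]
  exact (wflow_rot w _).symm
end
end

section
/-! ### Part 3: the trace formula -/

lemma trace_pow_mul {ι : Type*} [Fintype ι] [DecidableEq ι] (B : Matrix ι ι ℂ) (m : ℕ) :
    ∀ K : Matrix ι ι ℂ, ∑ p : Fin (m + 1) → ι,
      (∏ i : Fin m, B (p i.castSucc) (p i.succ)) * K (p (Fin.last m)) (p 0)
      = Matrix.trace (B ^ m * K) := by
  induction m with
  | zero =>
    intro K
    simp only [Finset.univ_eq_empty, Finset.prod_empty, one_mul, pow_zero]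
    rw [Matrix.trace]
    refine Fintype.sum_equiv (Equiv.funUnique (Fin 1) ι) _ _ (fun p => ?_)
    simp [Equiv.funUnique]
  | succ m ih =>
    intro K
    have : B ^ (m + 1) * K = B * (B ^ m * K) := by rw [pow_succ', Matrix.mul_assoc]
    rw [this, Matrix.trace_mul_comm, Matrix.mul_assoc, ← ih (K * B),
      ← (Fin.consEquiv (fun _ => ι)).sum_comp, Fintype.sum_prod_type, Finset.sum_comm]
    apply Finset.sum_congr rfl
    intro p _
    rw [Matrix.mul_apply, Finset.mul_sum]
    apply Finset.sum_congr rfl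
    intro a _
    rw [Fin.prod_univ_succ]
    simp only [Fin.consEquiv_apply]
    have e1 : (Fin.cons a p : Fin (m + 2) → ι) (Fin.last (m + 1)) = p (Fin.last m) := by
      rw [← Fin.succ_last, Fin.cons_succ]
    have e2 : ∀ i : Fin m, (Fin.cons a p : Fin (m + 2) → ι) i.succ.castSucc = p i.castSucc := by
      intro i
      rw [← Fin.succ_castSucc, Fin.cons_succ]
    simp only [e1, e2, Fin.cons_succ, Fin.castSucc_zero, Fin.cons_zero]
    ring

lemma trace_pow_eq {ι : Type*} [Fintype ι] [DecidableEq ι] (B : Matrix ι ι ℂ) (n : ℕ) [NeZero n] :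
    Matrix.trace (B ^ n) = ∑ p : ZMod n → ι, ∏ i, B (p i) (p (i + 1)) := by
  obtain ⟨m, rfl⟩ := Nat.exists_eq_succ_of_ne_zero (NeZero.ne n)
  rw [pow_succ, ← trace_pow_mul]
  change _ = ∑ p : Fin (m + 1) → ι, ∏ i : Fin (m + 1), B (p i) (p (i + 1))
  apply Finset.sum_congr rfl
  intro p _
  rw [Fin.prod_univ_castSucc]
  simp

section bass
variable {V : Type*} [Fintype V] [DecidableEq V] (M : Matrix V V ℂ)

def bS : Matrix V (V × V) ℂ := fun v e => if v = e.1 then M e.1 e.2 else 0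
def bT (V : Type*) [DecidableEq V] : Matrix (V × V) V ℂ :=
  fun e v => if e.2 = v ∧ e.1 ≠ e.2 then 1 else 0
def bT' (V : Type*) [DecidableEq V] : Matrix V (V × V) ℂ :=
  fun v e => if v = e.2 ∧ e.1 ≠ e.2 then 1 else 0
def bJ : Matrix (V × V) (V × V) ℂ := fun e f => if e.2 = f.1 ∧ e.1 = f.2 then M e.2 e.1 else 0
/-- The non-backtracking edge matrix. -/
def bB : Matrix (V × V) (V × V) ℂ :=
  fun e f => if e.2 = f.1 ∧ e.1 ≠ e.2 ∧ e.1 ≠ f.2 then M f.1 f.2 else 0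

lemma bB_eq (hd : ∀ a, M a a = 0) : bB M = bT V * bS M - bJ M := by
  ext ⟨a, b⟩ ⟨c, d⟩
  simp only [bB, bT, bS, bJ, Matrix.sub_apply, Matrix.mul_apply]
  rw [Finset.sum_eq_single b]
  · by_cases h1 : b = c
    · subst h1
      by_cases h2 : a = b
      · subst h2
        simp [hd]
      · by_cases h3 : a = d
        · subst h3; simp [h2]
        · simp [h2, h3]
    · simp [h1]
  · intro v _ hv
    simp [hv.symm]
  · simp

lemma bS_mul_bT (hd : ∀ a, M a a = 0) : bS M * bT V = M := by
  ext a b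
  rw [Matrix.mul_apply, Fintype.sum_prod_type, Finset.sum_eq_single a, Finset.sum_eq_single b]
  · by_cases h : a = b
    · subst h; simp [bS, bT, hd]
    · simp [bS, bT, h]
  · intro c _ hc; simp [bS, bT, hc]
  · simp
  · intro c _ hc
    simp [bS, hc.symm]
  · simp

lemma bS_mul_bJ (hd : ∀ a, M a a = 0)
    (hu : ∀ a b, a ≠ b → M a b * M b a = 1) : bS M * bJ M = bT' V := by
  ext v ⟨c, d⟩
  rw [Matrix.mul_apply, Fintype.sum_prod_type, Finset.sum_eq_single v, Finset.sum_eq_single c]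
  · by_cases h : v = d
    · subst h
      by_cases h2 : c = v
      · subst h2; simp [bS, bJ, bT', hd]
      · simp [bS, bJ, bT', h2, hu v c (Ne.symm h2)]
    · simp [bS, bJ, bT', h]
  · intro b _ hb; simp [bS, bJ, hb]
  · simp
  · intro b _ hb; simp [bS, hb.symm]
  · simp

lemma bT'_mul_bT : bT' V * bT V = ((Fintype.card V : ℂ) - 1) • (1 : Matrix V V ℂ) := by
  ext u v
  rw [Matrix.mul_apply, Fintype.sum_prod_type]
  simp only [bT', bT]
  have : ∀ a, ∑ b, ((if u = b ∧ a ≠ b then (1 : ℂ) else 0) * if b = v ∧ a ≠ b then 1 else 0)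
      = if u = v then (1 - if a = v then 1 else 0) else 0 := by
    intro a
    rw [Finset.sum_eq_single u]
    · by_cases h : u = v
      · subst h
        by_cases h2 : a = u <;> simp [h2]
      · simp [h]
    · intro b _ hb; simp [hb.symm]
    · simp
  simp only [this]
  by_cases h : u = v
  · subst h; simp
  · simp [h]

lemma bT'_mul_bJ (hd : ∀ a, M a a = 0) : bT' V * bJ M = bS M := by
  ext v ⟨c, d⟩
  rw [Matrix.mul_apply, Fintype.sum_prod_type, Finset.sum_eq_single d, Finset.sum_eq_single v]
  · by_cases h : v = c
    · subst h
      by_cases h2 : d = v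
      · subst h2; simp [bS, bJ, bT', hd]
      · simp [bS, bJ, bT', h2]
    · simp [bS, bJ, h]
  · intro b _ hb; simp [bT', hb.symm]
  · simp
  · intro a _ ha
    apply Finset.sum_eq_zero
    intro b _
    simp [bJ, ha]
  · simp

lemma bJ_bJ_bB (hd : ∀ a, M a a = 0)
    (hu : ∀ a b, a ≠ b → M a b * M b a = 1) : bJ M * (bJ M * bB M) = bB M := by
  ext ⟨a, b⟩ f
  rw [Matrix.mul_apply, Finset.sum_eq_single (b, a), Matrix.mul_apply, Finset.sum_eq_single (a, b)]
  · by_cases h : a = b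
    · subst h; simp [bJ, bB]
    · simp [bJ]
      rw [← mul_assoc, hu b a (Ne.symm h), one_mul]
  · rintro ⟨c, d⟩ _ hc
    have : ¬ (a = c ∧ b = d) := by
      rintro ⟨rfl, rfl⟩; exact hc rfl
    simp only [bJ, if_neg this, zero_mul]
  · simp
  · rintro ⟨c, d⟩ _ hc
    have : ¬ (b = c ∧ a = d) := by
      rintro ⟨rfl, rfl⟩; exact hc rfl
    simp only [bJ, if_neg this, zero_mul]
  · simp

lemma bT'_mul_bB (hd : ∀ a, M a a = 0) : bT' V * bB M = ((Fintype.card V : ℂ) - 2) • bS M := by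
  rw [bB_eq M hd, Matrix.mul_sub, ← Matrix.mul_assoc, bT'_mul_bT, bT'_mul_bJ M hd,
    Matrix.smul_mul, Matrix.one_mul]
  module

lemma bS_mul_bB (hd : ∀ a, M a a = 0)
    (hu : ∀ a b, a ≠ b → M a b * M b a = 1) : bS M * bB M = M * bS M - bT' V := by
  rw [bB_eq M hd, Matrix.mul_sub, ← Matrix.mul_assoc, bS_mul_bT M hd, bS_mul_bJ M hd hu]

/-- weighted non-backtracking walks of length `m + 1`. -/
def bA (m : ℕ) : Matrix V V ℂ := bS M * (bB M ^ m * bT V)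

lemma bA_zero (hd : ∀ a, M a a = 0) : bA M 0 = M := by simp [bA, bS_mul_bT M hd]

lemma bA_one (hd : ∀ a, M a a = 0)
    (hu : ∀ a b, a ≠ b → M a b * M b a = 1) : bA M 1 = M * M - ((Fintype.card V : ℂ) - 1) • 1 := by
  rw [bA, pow_one, ← Matrix.mul_assoc, bS_mul_bB M hd hu, Matrix.sub_mul, Matrix.mul_assoc,
    bS_mul_bT M hd, bT'_mul_bT]

lemma bA_succ (hd : ∀ a, M a a = 0)
    (hu : ∀ a b, a ≠ b → M a b * M b a = 1) (m : ℕ) : bA M (m + 2) = M * bA M (m + 1) - ((Fintype.card V : ℂ) - 2) • bA M m := by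
  have h : bT' V * (bB M ^ (m + 1) * bT V) = ((Fintype.card V : ℂ) - 2) • bA M m := by
    rw [pow_succ', Matrix.mul_assoc, ← Matrix.mul_assoc, bT'_mul_bB M hd, Matrix.smul_mul, bA]
  rw [bA, pow_succ', Matrix.mul_assoc, ← Matrix.mul_assoc, bS_mul_bB M hd hu, Matrix.sub_mul, h,
    Matrix.mul_assoc]
  rfl

lemma trace_bB_rec (hd : ∀ a, M a a = 0)
    (hu : ∀ a b, a ≠ b → M a b * M b a = 1) (m : ℕ) : Matrix.trace (bB M ^ (m + 3)) =
    Matrix.trace (bA M (m + 2)) - ((Fintype.card V : ℂ) - 2) * Matrix.trace (bA M m)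
      + Matrix.trace (bB M ^ (m + 1)) := by
  have h : bT' V * (bB M ^ (m + 1) * bT V) = ((Fintype.card V : ℂ) - 2) • bA M m := by
    rw [pow_succ', Matrix.mul_assoc, ← Matrix.mul_assoc, bT'_mul_bB M hd, Matrix.smul_mul, bA]
  have hB := bB_eq M hd
  have e1 : bB M ^ (m + 3) = bB M ^ (m + 2) * (bT V * bS M) - bB M ^ (m + 2) * bJ M := by
    rw [← Matrix.mul_sub, ← hB, ← pow_succ]
  have e2 : bB M ^ (m + 2) * bJ M = bB M ^ (m + 1) * (bT V * bT' V) - bB M ^ (m + 1) * (bJ M * bJ M) := by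
    rw [← bS_mul_bJ M hd hu, ← Matrix.mul_sub, ← Matrix.mul_assoc (bT V), ← Matrix.sub_mul, ← hB,
      ← Matrix.mul_assoc, ← pow_succ]
  have e3 : Matrix.trace (bB M ^ (m + 2) * (bT V * bS M)) = Matrix.trace (bA M (m + 2)) := by
    rw [← Matrix.mul_assoc, Matrix.trace_mul_comm, bA]
  have e4 : Matrix.trace (bB M ^ (m + 1) * (bT V * bT' V))
      = ((Fintype.card V : ℂ) - 2) * Matrix.trace (bA M m) := by
    rw [← Matrix.mul_assoc, Matrix.trace_mul_comm, h, Matrix.trace_smul, smul_eq_mul]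
  have e5 : Matrix.trace (bB M ^ (m + 1) * (bJ M * bJ M)) = Matrix.trace (bB M ^ (m + 1)) := by
    rw [Matrix.trace_mul_comm, pow_succ', ← Matrix.mul_assoc, Matrix.mul_assoc (bJ M),
      bJ_bJ_bB M hd hu]
  rw [e1, Matrix.trace_sub, e2, Matrix.trace_sub, e3, e4, e5]
  ring

/-- rescaled Chebyshev polynomials of `M`. -/
def chT (q : ℂ) : ℕ → Matrix V V ℂ
  | 0 => (2 : ℂ) • 1
  | 1 => M
  | (m + 2) => M * chT q (m + 1) - q • chT q m

lemma bA_chT (hd : ∀ a, M a a = 0)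
    (hu : ∀ a b, a ≠ b → M a b * M b a = 1) (m : ℕ) : bA M (m + 2) - ((Fintype.card V : ℂ) - 2) • bA M m
    = chT M ((Fintype.card V : ℂ) - 2) (m + 3) - chT M ((Fintype.card V : ℂ) - 2) (m + 1) := by
  set q := (Fintype.card V : ℂ) - 2 with hq
  induction m using Nat.strong_induction_on with
  | _ m ih =>
    match m with
    | 0 =>
      rw [bA_succ M hd hu, ← hq, bA_one M hd hu, bA_zero M hd]
      simp only [chT]
      rw [show (Fintype.card V : ℂ) - 1 = q + 1 by rw [hq]; ring]
      simp only [Matrix.mul_sub, Matrix.mul_smul, Matrix.mul_one]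
      module
    | 1 =>
      rw [bA_succ M hd hu, bA_succ M hd hu, ← hq, bA_one M hd hu, bA_zero M hd]
      simp only [chT]
      rw [show (Fintype.card V : ℂ) - 1 = q + 1 by rw [hq]; ring]
      simp only [Matrix.mul_sub, Matrix.mul_smul, Matrix.mul_one]
      module
    | (m + 2) =>
      have h1 := ih m (by omega)
      have h2 := ih (m + 1) (by omega)
      have e1 : bA M (m + 2 + 2) - q • bA M (m + 2)
          = M * (bA M (m + 1 + 2) - q • bA M (m + 1)) - q • (bA M (m + 2) - q • bA M m) := by
        rw [bA_succ M hd hu (m + 2), ← hq]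
        conv_lhs => rw [bA_succ M hd hu m, ← hq]
        rw [bA_succ M hd hu m, ← hq]
        simp only [Matrix.mul_sub, Matrix.mul_smul]
        module
      have e2 : ∀ j, chT M q (j + 2) = M * chT M q (j + 1) - q • chT M q j := fun j => by rw [chT]
      rw [e1, h1, h2, e2 (m + 3), e2 (m + 1)]
      simp only [Matrix.mul_sub, Matrix.mul_smul]
      module

/-- The constant in the trace formula. -/
def bK (V : Type*) [Fintype V] (m : ℕ) : ℂ :=
  if Even m then 2 * ((Fintype.card V : ℂ) - 2) * Fintype.card V
    - Fintype.card V * ((Fintype.card V : ℂ) - 1) else 0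

lemma trace_bB_chT (hd : ∀ a, M a a = 0)
    (hu : ∀ a b, a ≠ b → M a b * M b a = 1) (m : ℕ) : Matrix.trace (bB M ^ (m + 1)) =
    Matrix.trace (chT M ((Fintype.card V : ℂ) - 2) (m + 1)) + bK V (m + 1) := by
  induction m using Nat.strong_induction_on with
  | _ m ih =>
    match m with
    | 0 =>
      simp only [chT, bK, zero_add, pow_one]
      simp only [Matrix.trace, Matrix.diag, hd]
      simp only [bB, Finset.sum_const_zero]
      simp
      apply Finset.sum_eq_zero
      intro e _
      rw [if_neg (fun h => h.2 h.1.symm)]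
    | 1 =>
      have h1 : Matrix.trace (bB M ^ (1 + 1)) = 0 := by
        rw [pow_succ, pow_one, Matrix.trace]
        apply Finset.sum_eq_zero
        rintro ⟨a, b⟩ _
        rw [Matrix.diag_apply, Matrix.mul_apply]
        apply Finset.sum_eq_zero
        rintro ⟨c, d⟩ _
        simp only [bB]
        by_cases h : d = a
        · subst h; simp
        · simp [h]
      have h2 : Matrix.trace (M * M) = Fintype.card V * ((Fintype.card V : ℂ) - 1) := by
        rw [Matrix.trace]
        have : ∀ a, Matrix.diag (M * M) a = (Fintype.card V : ℂ) - 1 := by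
          intro a
          rw [Matrix.diag_apply, Matrix.mul_apply]
          have : ∀ b, M a b * M b a = 1 - if a = b then 1 else 0 := by
            intro b
            by_cases h : a = b
            · subst h; simp [hd]
            · simp [h, hu a b h]
          simp [this]
        rw [Finset.sum_congr rfl (fun a _ => this a)]
        simp
        ring
      rw [h1]
      simp only [chT, bK, Matrix.trace_sub, h2, Matrix.trace_smul, Matrix.trace_one, smul_eq_mul]
      simp
      ring
    | (m + 2) =>
      have h1 := ih m (by omega)
      have h2 := congrArg Matrix.trace (bA_chT M hd hu m)
      simp only [Matrix.trace_sub, Matrix.trace_smul, smul_eq_mul] at h2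
      rw [trace_bB_rec M hd hu, h2, h1]
      have : bK V (m + 2 + 1) = bK V (m + 1) := by
        unfold bK
        rw [show m + 2 + 1 = (m + 1) + 2 by ring]
        simp [Nat.even_add]
      rw [this]
      ring

open Classical in
lemma trace_bB_walks (n : ℕ) [NeZero n] : Matrix.trace (bB M ^ n) =
    ∑ w : ZMod n → V, if IsCnb w then ∏ i, M (w i) (w (i + 1)) else 0 := by
  rw [trace_pow_eq]
  symm
  refine Fintype.sum_of_injective (fun (w : ZMod n → V) i => (w i, w (i + 1))) ?_ _ _ ?_ ?_
  · intro w w' h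
    ext i
    have := congrFun h i
    simp at this
    exact this.1
  · intro p hp
    by_contra hne
    apply hp
    have h := fun i => Finset.prod_ne_zero_iff.1 hne i (Finset.mem_univ i)
    refine ⟨fun i => (p i).1, ?_⟩
    ext i : 1
    have := h i
    simp only [bB] at this
    have h2 : (p i).2 = (p (i + 1)).1 := by
      by_contra h3
      simp [h3] at this
    simp [← h2]
  · intro w
    simp only [bB, true_and]
    rw [Finset.prod_ite_zero]
    have : (∀ i ∈ (Finset.univ : Finset (ZMod n)), w i ≠ w (i + 1) ∧ w i ≠ w (i + 1 + 1)) ↔ IsCnb w := by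
      simp only [IsCnb, add_assoc, one_add_one_eq_two, Finset.mem_univ, true_imp_iff]
    simp only [this]
    congr 1
    exact (Fintype.prod_equiv (Equiv.addRight 1) _ _ (fun j => by simp)).symm

end bass

lemma chT_cheb {V : Type*} [Fintype V] [DecidableEq V] (M : Matrix V V ℂ) (s : ℂ) (hs : s ≠ 0) (n : ℕ) :
    (2 * s ^ n) • Polynomial.aeval ((1 / (2 * s)) • M) (Polynomial.Chebyshev.T ℂ n) = chT M (s ^ 2) n := by
  induction n using Nat.strong_induction_on with
  | _ n ih =>
    match n with
    | 0 => simp [chT]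
    | 1 =>
      simp [chT, smul_smul]
      rw [show 2 * s * (s⁻¹ * 2⁻¹) = 1 by field_simp, one_smul]
    | (n + 2) =>
      have h1 := ih n (by omega)
      have h2 := ih (n + 1) (by omega)
      rw [chT, ← h1, ← h2]
      push_cast
      rw [Polynomial.Chebyshev.T_add_two]
      simp only [map_sub, map_mul, Polynomial.aeval_X, map_ofNat]
      rw [smul_sub, mul_assoc, Matrix.smul_mul, Matrix.mul_smul M]
      have e2 : (2 : Matrix V V ℂ) = (2 : ℂ) • 1 := by
        ext i j
        simp [Matrix.ofNat_apply, Matrix.one_apply]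
      rw [e2, Matrix.smul_mul, Matrix.one_mul, smul_smul, smul_smul, smul_smul]
      congr 2
      · field_simp
        ring
      · ring
end

section
/-! ### Part 4: characters of the torus of phases -/

instance : IsProbabilityMeasure uniformPhase := by
  constructor
  have h : (0 : ℝ) < 2 * Real.pi := by positivity
  simp only [uniformPhase, Measure.smul_apply, Measure.restrict_apply_univ, Real.volume_Ico, sub_zero,
    smul_eq_mul]
  exact ENNReal.inv_mul_cancel (by simpa using h) ENNReal.ofReal_ne_top

instance (N : ℕ) : IsProbabilityMeasure (phaseMeasure N) := by
  unfold phaseMeasure; infer_instance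

lemma integral_uniformPhase {E : Type*} [NormedAddCommGroup E] [NormedSpace ℝ E] (f : ℝ → E) :
    ∫ x, f x ∂uniformPhase = (2 * Real.pi)⁻¹ • ∫ x in (0)..(2 * Real.pi), f x := by
  have h : (0 : ℝ) < 2 * Real.pi := by positivity
  rw [uniformPhase, integral_smul_measure, intervalIntegral.integral_of_le h.le,
    integral_Ico_eq_integral_Ioo, integral_Ioc_eq_integral_Ioo, ENNReal.toReal_inv,
    ENNReal.toReal_ofReal h.le]

lemma integral_char (c : ℤ) :
    ∫ x, Complex.exp (Complex.I * (c * (x : ℂ))) ∂uniformPhase = if c = 0 then 1 else 0 := by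
  rw [integral_uniformPhase]
  split_ifs with h
  · subst h
    have : (Real.pi : ℂ) ≠ 0 := by exact_mod_cast Real.pi_ne_zero
    simp
    field_simp
  · have hc : Complex.I * (c : ℂ) ≠ 0 := by simp [h]
    have := integral_exp_mul_complex (a := 0) (b := 2 * Real.pi) hc
    simp only [← mul_assoc]
    rw [this]
    have e : Complex.I * (c : ℂ) * ((2 * Real.pi : ℝ) : ℂ) = c * (2 * Real.pi * Complex.I) := by
      push_cast; ring
    rw [e, Complex.exp_int_mul_two_pi_mul_I]
    simp

variable {N : ℕ}

/-- The phase of a character. -/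
def cph (c : Fin N → Fin N → ℤ) (ω : Fin N → Fin N → ℝ) : ℝ := ∑ a, ∑ b, (c a b : ℝ) * ω a b

/-- Characters. -/
def chi (c : Fin N → Fin N → ℤ) (ω : Fin N → Fin N → ℝ) : ℂ := Complex.exp (Complex.I * (cph c ω : ℂ))

lemma continuous_cph (c : Fin N → Fin N → ℤ) : Continuous (cph c) := by
  unfold cph; fun_prop

lemma continuous_chi (c : Fin N → Fin N → ℤ) : Continuous (chi c) := by
  unfold chi
  have := continuous_cph c
  fun_prop

lemma norm_chi (c : Fin N → Fin N → ℤ) (ω) : ‖chi c ω‖ = 1 := by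
  rw [chi, mul_comm]
  exact Complex.norm_exp_ofReal_mul_I _

lemma cph_sub (c d : Fin N → Fin N → ℤ) (ω) : cph (c - d) ω = cph c ω - cph d ω := by
  simp [cph, sub_mul, Finset.sum_sub_distrib]

lemma cph_neg (c : Fin N → Fin N → ℤ) (ω) : cph (-c) ω = - cph c ω := by
  simp [cph]

lemma chi_mul_conj (c d : Fin N → Fin N → ℤ) (ω) :
    chi c ω * (starRingEnd ℂ) (chi d ω) = chi (c - d) ω := by
  simp only [chi, cph_sub]
  rw [← Complex.exp_conj, ← Complex.exp_add]
  congr 1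
  simp
  ring

lemma integral_chi (c : Fin N → Fin N → ℤ) :
    ∫ ω, chi c ω ∂(phaseMeasure N) = if c = 0 then 1 else 0 := by
  have h : ∀ ω : Fin N → Fin N → ℝ, chi c ω = ∏ a, ∏ b, Complex.exp (Complex.I * (c a b * (ω a b : ℂ))) := by
    intro ω
    simp only [chi, cph]
    push_cast
    rw [Finset.mul_sum, Complex.exp_sum]
    apply Finset.prod_congr rfl
    intro a _
    rw [Finset.mul_sum, Complex.exp_sum]
  simp only [h]
  unfold phaseMeasure
  rw [integral_fintype_prod_eq_prod (μ := fun _ : Fin N => Measure.pi fun _ : Fin N => uniformPhase)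
    (fun a (x : Fin N → ℝ) => ∏ b, Complex.exp (Complex.I * (c a b * (x b : ℂ))))]
  have h2 : ∀ a, ∫ x : Fin N → ℝ, ∏ b, Complex.exp (Complex.I * (c a b * (x b : ℂ)))
      ∂(Measure.pi fun _ : Fin N => uniformPhase) = ∏ b, if c a b = 0 then 1 else 0 := by
    intro a
    rw [integral_fintype_prod_eq_prod (μ := fun _ : Fin N => uniformPhase)
      (fun b (x : ℝ) => Complex.exp (Complex.I * (c a b * (x : ℂ))))]
    exact Finset.prod_congr rfl (fun b _ => integral_char _)
  simp only [h2]
  split_ifs with h0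
  · subst h0; simp
  · have : ∃ a b, c a b ≠ 0 := by
      by_contra hcon
      push Not at hcon
      exact h0 (by ext a b; exact hcon a b)
    obtain ⟨a, b, hab⟩ := this
    apply Finset.prod_eq_zero (Finset.mem_univ a)
    apply Finset.prod_eq_zero (Finset.mem_univ b)
    simp [hab]

/-- Bounded continuous functions are integrable. -/
lemma integrable_bdd {Ω E : Type*} [TopologicalSpace Ω] [MeasurableSpace Ω] [BorelSpace Ω] [NormedAddCommGroup E]
    [SecondCountableTopologyEither Ω E] (μ : Measure Ω) [IsFiniteMeasure μ]
    (f : Ω → E) (hf : Continuous f) (C : ℝ) (hC : ∀ ω, ‖f ω‖ ≤ C) : Integrable f μ :=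
  Integrable.of_bound hf.aestronglyMeasurable C (ae_of_all _ hC)

lemma integral_norm_le_sqrt {Ω : Type*} [MeasurableSpace Ω] (μ : Measure Ω) [IsProbabilityMeasure μ]
    (f : Ω → ℝ) (hf : Integrable f μ) (hf2 : Integrable (fun ω => f ω ^ 2) μ) :
    ∫ ω, |f ω| ∂μ ≤ Real.sqrt (∫ ω, f ω ^ 2 ∂μ) := by
  apply Real.le_sqrt_of_sq_le
  set A := ∫ ω, |f ω| ∂μ with hA
  have h : 0 ≤ ∫ ω, (|f ω| - A) ^ 2 ∂μ := integral_nonneg (fun ω => sq_nonneg _)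
  have e : ∀ ω, (|f ω| - A) ^ 2 = f ω ^ 2 - 2 * A * |f ω| + A ^ 2 := by
    intro ω; rw [← sq_abs (f ω)]; ring
  simp only [e] at h
  have i1 : Integrable (fun ω => 2 * A * |f ω|) μ := hf.abs.const_mul _
  have i2 : Integrable (fun ω => f ω ^ 2 - 2 * A * |f ω|) μ := hf2.sub i1
  rw [integral_add i2 (integrable_const _), integral_sub hf2 i1, integral_const_mul, ← hA] at h
  simp at h
  nlinarith

section
open Classical

/-- `L²` bound for trigonometric polynomials. -/
lemma l2_bound {X : Type*} (S : Finset X) (α : X → ℂ) (c : X → Fin N → Fin N → ℤ) (K : ℝ)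
    (hK : ∀ x ∈ S, ‖α x‖ ≤ K) :
    ∫ ω, ‖∑ x ∈ S, α x * chi (c x) ω‖ ^ 2 ∂(phaseMeasure N)
      ≤ K ^ 2 * ((S ×ˢ S).filter (fun p => c p.1 = c p.2)).card := by
  have h1 : ∀ ω, ((‖∑ x ∈ S, α x * chi (c x) ω‖ ^ 2 : ℝ) : ℂ)
      = ∑ p ∈ S ×ˢ S, α p.1 * (starRingEnd ℂ) (α p.2) * chi (c p.1 - c p.2) ω := by
    intro ω
    push_cast
    rw [← Complex.mul_conj', map_sum, Finset.sum_mul_sum, Finset.sum_product]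
    apply Finset.sum_congr rfl
    intro x _
    apply Finset.sum_congr rfl
    intro y _
    rw [← chi_mul_conj, map_mul]
    ring
  have h2 : ((∫ ω, ‖∑ x ∈ S, α x * chi (c x) ω‖ ^ 2 ∂(phaseMeasure N) : ℝ) : ℂ)
      = ∑ p ∈ S ×ˢ S, α p.1 * (starRingEnd ℂ) (α p.2) * (if c p.1 = c p.2 then 1 else 0) := by
    rw [← integral_complex_ofReal]
    simp only [h1]
    rw [integral_finsetSum]
    · apply Finset.sum_congr rfl
      intro p _
      rw [integral_const_mul, integral_chi]
      simp [sub_eq_zero]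
    · intro p _
      apply Integrable.const_mul
      exact integrable_bdd _ _ (continuous_chi _) 1 (fun ω => (norm_chi _ _).le)
  have h3 : ∫ ω, ‖∑ x ∈ S, α x * chi (c x) ω‖ ^ 2 ∂(phaseMeasure N)
      ≤ ‖((∫ ω, ‖∑ x ∈ S, α x * chi (c x) ω‖ ^ 2 ∂(phaseMeasure N) : ℝ) : ℂ)‖ := by
    rw [Complex.norm_real]; exact le_abs_self _
  refine h3.trans ?_
  rw [h2]
  refine (norm_sum_le _ _).trans ?_
  rw [Finset.card_filter, Nat.cast_sum, Finset.mul_sum]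
  apply Finset.sum_le_sum
  intro p hp
  rw [Finset.mem_product] at hp
  split_ifs with h
  · simp only [mul_one, norm_mul, RCLike.norm_conj, Nat.cast_one]
    rw [sq]
    exact mul_le_mul (hK _ hp.1) (hK _ hp.2) (norm_nonneg _) ((norm_nonneg _).trans (hK _ hp.1))
  · simp

lemma l1_bound {X : Type*} (S : Finset X) (α : X → ℂ) (c : X → Fin N → Fin N → ℤ) (K : ℝ) (hK0 : 0 ≤ K)
    (hK : ∀ x ∈ S, ‖α x‖ ≤ K) :
    ∫ ω, ‖∑ x ∈ S, α x * chi (c x) ω‖ ∂(phaseMeasure N)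
      ≤ K * Real.sqrt (((S ×ˢ S).filter (fun p => c p.1 = c p.2)).card) := by
  have hc : Continuous (fun ω => ∑ x ∈ S, α x * chi (c x) ω) := by
    apply continuous_finsetSum
    intro x _
    exact continuous_const.mul (continuous_chi _)
  have hb : ∀ ω, ‖∑ x ∈ S, α x * chi (c x) ω‖ ≤ ∑ x ∈ S, ‖α x‖ := by
    intro ω
    refine (norm_sum_le _ _).trans (Finset.sum_le_sum ?_)
    intro x _
    rw [norm_mul, norm_chi, mul_one]
  have := integral_norm_le_sqrt (phaseMeasure N) (fun ω => ‖∑ x ∈ S, α x * chi (c x) ω‖)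
    (integrable_bdd _ _ hc.norm (∑ x ∈ S, ‖α x‖) (by simpa using hb))
    (integrable_bdd _ _ (hc.norm.pow 2) ((∑ x ∈ S, ‖α x‖) ^ 2) (by
      intro ω
      rw [norm_pow, norm_norm]
      exact pow_le_pow_left₀ (norm_nonneg _) (hb ω) 2))
  simp only [abs_norm] at this
  refine this.trans ?_
  refine (Real.sqrt_le_sqrt (l2_bound S α c K hK)).trans ?_
  rw [Real.sqrt_mul (sq_nonneg _), Real.sqrt_sq hK0]
end

/-- frequency vector of a closed walk. -/
def wc {n : ℕ} [NeZero n] (w : ZMod n → Fin N) (a b : Fin N) : ℤ := if a < b then wflow w a b else 0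

section
variable {n m : ℕ} [NeZero n] [NeZero m]

lemma wc_eq_iff (w : ZMod n → Fin N) (w' : ZMod m → Fin N) : wc w = wc w' ↔ wflow w = wflow w' := by
  constructor
  · intro h
    have h1 : ∀ a b, a < b → wflow w a b = wflow w' a b := by
      intro a b hab
      have := congrFun (congrFun h a) b
      simpa [wc, hab] using this
    ext a b
    rcases lt_trichotomy a b with hab | hab | hab
    · exact h1 a b hab
    · subst hab
      have e1 := wflow_antisymm w a a
      have e2 := wflow_antisymm w' a a
      omega
    · rw [wflow_antisymm w b a, wflow_antisymm w' b a, h1 b a hab]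
  · intro h; ext a b; simp [wc, h]

lemma wc_sub_iff (w w2 : ZMod n → Fin N) (w' w2' : ZMod m → Fin N) (h : wc w - wc w' = wc w2 - wc w2') :
    ∀ a b, wflow w a b - wflow w' a b = wflow w2 a b - wflow w2' a b := by
  have h1 : ∀ a b, a < b → wflow w a b - wflow w' a b = wflow w2 a b - wflow w2' a b := by
    intro a b hab
    have := congrFun (congrFun h a) b
    simpa [wc, hab] using this
  intro a b
  rcases lt_trichotomy a b with hab | hab | hab
  · exact h1 a b hab
  · subst hab
    have e1 := wflow_antisymm w a a
    have e2 := wflow_antisymm w' a a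
    have e3 := wflow_antisymm w2 a a
    have e4 := wflow_antisymm w2' a a
    omega
  · have e1 := wflow_antisymm w b a
    have e2 := wflow_antisymm w' b a
    have e3 := wflow_antisymm w2 b a
    have e4 := wflow_antisymm w2' b a
    have e5 := h1 b a hab
    omega

lemma sum_wc_mul {R : Type*} [CommRing R] (w : ZMod n → Fin N) (g : Fin N → Fin N → R)
    (hg : ∀ a b, g b a = - g a b) (hg0 : ∀ a, g a a = 0) :
    ∑ a, ∑ b, (wc w a b : R) * g a b = ∑ i, g (w i) (w (i + 1)) := by
  have h := sum_wflow_mul w (fun a b => if a < b then g a b else 0)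
  have e : ∀ a b, (wc w a b : R) * g a b = (wflow w a b : R) * (if a < b then g a b else 0) := by
    intro a b
    by_cases hab : a < b <;> simp [wc, hab]
  simp only [e, h]
  apply Finset.sum_congr rfl
  intro i _
  rcases lt_trichotomy (w i) (w (i + 1)) with hab | hab | hab
  · simp [hab, hab.not_gt]
  · simp [hab, hg0]
  · simp [hab, hab.not_gt, ← hg]

lemma prod_ume (w : ZMod n → Fin N) (hw : IsCnb w) (ω : Fin N → Fin N → ℝ) :
    ∏ i, umeMatrix N (phases N ω) (w i) (w (i + 1)) = chi (wc w) ω := by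
  have h1 : cph (wc w) ω = ∑ i, phases N ω (w i) (w (i + 1)) := by
    rw [← sum_wc_mul w (phases N ω)]
    · unfold cph
      apply Finset.sum_congr rfl
      intro a _
      apply Finset.sum_congr rfl
      intro b _
      by_cases hab : a < b <;> simp [wc, phases, hab]
    · intro a b
      rcases lt_trichotomy a b with hab | hab | hab
      · simp [phases, hab, hab.not_gt]
      · subst hab; simp [phases]
      · simp [phases, hab, hab.not_gt]
    · intro a; simp [phases]
  unfold chi
  rw [h1]
  push_cast
  rw [Finset.mul_sum, Complex.exp_sum]
  apply Finset.prod_congr rfl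
  intro i _
  simp [umeMatrix, (hw i).1]

/-- The inner product of frequency vectors. -/
def wip (w : ZMod n → Fin N) (w' : ZMod m → Fin N) : ℤ := ∑ a, ∑ b, wc w a b * wc w' a b

lemma wip_eq (w : ZMod n → Fin N) (w' : ZMod m → Fin N) :
    wip w w' = ∑ i, wflow w' (w i) (w (i + 1)) := by
  rw [← sum_wc_mul w (wflow w') (fun a b => wflow_antisymm w' a b)
    (fun a => by have := wflow_antisymm w' a a; omega)]
  unfold wip
  apply Finset.sum_congr rfl
  intro a _
  apply Finset.sum_congr rfl
  intro b _
  by_cases hab : a < b <;> simp [wc, hab]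

lemma wip_self (hn : 3 ≤ n) (w : ZMod n → Fin N) (hw : Function.Injective w) : wip w w = n := by
  rw [wip_eq]
  simp [wflow_own_edge hn w hw, ZMod.card]

lemma abs_wip_le (w : ZMod n → Fin N) (w' : ZMod m → Fin N) : |wip w w'| ≤ n * m := by
  rw [wip_eq]
  refine (Finset.abs_sum_le_sum_abs _ _).trans ?_
  refine (Finset.sum_le_sum (fun i _ => abs_wflow_le w' _ _)).trans ?_
  simp [ZMod.card]

lemma wip_meet (w : ZMod n → Fin N) (w' : ZMod m → Fin N) (h : wip w w' ≠ 0) :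
    ∃ i i', w i = w' i' := by
  rw [wip_eq] at h
  obtain ⟨i, _, hi⟩ := Finset.exists_ne_zero_of_sum_ne_zero h
  obtain ⟨i', hi'⟩ := exists_of_wflow_ne _ _ _ hi
  exact ⟨i, i', hi'.symm⟩

lemma wc_neg (w : ZMod n → Fin N) : wc (fun j => w (-j)) = - wc w := by
  ext a b
  simp only [wc, wflow_neg, Pi.neg_apply]
  split_ifs <;> simp

lemma wc_ne_zero (hn : 3 ≤ n) (w : ZMod n → Fin N) (hw : Function.Injective w) : wc w ≠ 0 := by
  intro h
  have := wip_self hn w hw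
  simp [wip, h] at this
  omega
end
end

section
/-! ### Part 5: moment estimates -/

open Classical in
/-- simple closed walks -/
def injW (n N : ℕ) [NeZero n] : Finset (ZMod n → Fin N) := Finset.univ.filter Function.Injective

open Classical in
/-- non-simple cyclically non-backtracking closed walks -/
def badW (n N : ℕ) [NeZero n] : Finset (ZMod n → Fin N) :=
  Finset.univ.filter (fun w => IsCnb w ∧ ¬ Function.Injective w)

/-- contribution of the non-simple walks -/
def gBad (n N : ℕ) [NeZero n] (ω : Fin N → Fin N → ℝ) : ℂ := ∑ w ∈ badW n N, chi (wc w) ω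

/-- the scaling `√(N-2)` -/
def sN (N : ℕ) : ℝ := Real.sqrt ((N : ℝ) - 2)

/-- contribution of the simple walks to the Chebyshev trace -/
def Ft (N n : ℕ) [NeZero n] (ω : Fin N → Fin N → ℝ) : ℝ :=
  (1 / (2 * sN N ^ n)) * ∑ w ∈ injW n N, Real.cos (cph (wc w) ω)

lemma sN_pos {N : ℕ} (hN : 3 ≤ N) : 0 < sN N := by
  apply Real.sqrt_pos.2
  have : (3 : ℝ) ≤ N := by exact_mod_cast hN
  linarith

lemma sN_sq {N : ℕ} (hN : 3 ≤ N) : sN N ^ 2 = (N : ℝ) - 2 := by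
  apply Real.sq_sqrt
  have : (3 : ℝ) ≤ N := by exact_mod_cast hN
  linarith

lemma sN_ge {N : ℕ} (hN : 3 ≤ N) : (N : ℝ) ≤ 3 * sN N ^ 2 := by
  rw [sN_sq hN]
  have : (3 : ℝ) ≤ N := by exact_mod_cast hN
  linarith

section
variable {N n m : ℕ} [NeZero n] [NeZero m]

lemma chi_re (c : Fin N → Fin N → ℤ) (ω) : (chi c ω).re = Real.cos (cph c ω) := by
  rw [chi, mul_comm, Complex.exp_ofReal_mul_I_re]

lemma chi_im (c : Fin N → Fin N → ℤ) (ω) : (chi c ω).im = Real.sin (cph c ω) := by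
  rw [chi, mul_comm, Complex.exp_ofReal_mul_I_im]

lemma chebTrace_eq (hn : 3 ≤ n) (hN : 3 ≤ N) (ω : Fin N → Fin N → ℝ) :
    chebTrace N (phases N ω) n =
      (1 / (2 * (sN N : ℂ) ^ n)) * (∑ w ∈ injW n N, chi (wc w) ω + gBad n N ω - bK (Fin N) n) := by
  classical
  set M := umeMatrix N (phases N ω) with hM
  have hs : (sN N : ℂ) ≠ 0 := by exact_mod_cast (sN_pos hN).ne'
  have hd : ∀ a, M a a = 0 := by intro a; simp [hM, umeMatrix]
  have hu : ∀ a b, a ≠ b → M a b * M b a = 1 := by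
    intro a b hab
    simp only [hM, umeMatrix, if_neg hab, if_neg hab.symm]
    rw [← Complex.exp_add]
    have : phases N ω b a = - phases N ω a b := by
      rcases lt_trichotomy a b with h | h | h
      · simp [phases, h, h.not_gt]
      · exact absurd h hab
      · simp [phases, h, h.not_gt]
    rw [this]
    simp
  have h1 := chT_cheb M (sN N : ℂ) hs n
  have h2 : ((sN N : ℂ)) ^ 2 = (Fintype.card (Fin N) : ℂ) - 2 := by
    rw [Fintype.card_fin]
    exact_mod_cast congrArg (fun x : ℝ => (x : ℂ)) (sN_sq hN)
  rw [h2] at h1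
  have h3 : Matrix.trace (bB M ^ n) = Matrix.trace (chT M ((Fintype.card (Fin N) : ℂ) - 2) n) + bK (Fin N) n := by
    obtain ⟨k, rfl⟩ := Nat.exists_eq_succ_of_ne_zero (NeZero.ne n)
    exact trace_bB_chT M hd hu k
  rw [trace_bB_walks] at h3
  have h4 : (∑ w : ZMod n → Fin N, if IsCnb w then ∏ i, M (w i) (w (i + 1)) else 0)
      = ∑ w ∈ injW n N, chi (wc w) ω + gBad n N ω := by
    rw [← Finset.sum_filter, ← Finset.sum_filter_add_sum_filter_not _ (Function.Injective)]
    congr 1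
    · have : (Finset.univ.filter (fun w : ZMod n → Fin N => IsCnb w)).filter Function.Injective = injW n N := by
        ext w
        simp only [injW, Finset.mem_filter, Finset.mem_univ, true_and]
        exact ⟨fun h => h.2, fun h => ⟨isCnb_of_injective hn w h, h⟩⟩
      rw [this]
      apply Finset.sum_congr rfl
      intro w hw
      exact prod_ume w (isCnb_of_injective hn w (by simpa [injW] using hw)) ω
    · rw [Finset.filter_filter]
      apply Finset.sum_congr rfl
      intro w hw
      simp only [Finset.mem_filter] at hw
      exact prod_ume w hw.2.1 ω
  have h5 : chebTrace N (phases N ω) n = Matrix.trace (Polynomial.aeval ((1 / (2 * (sN N : ℂ))) • M)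
      (Polynomial.Chebyshev.T ℂ n)) := by
    unfold chebTrace scaledUme sN
    push_cast
    rfl
  have h6 := congrArg Matrix.trace h1
  rw [Matrix.trace_smul, smul_eq_mul, ← h5] at h6
  rw [← h4, h3, add_sub_cancel_right, ← h6]
  field_simp

lemma continuous_gBad : Continuous (gBad n N) := by
  unfold gBad
  exact continuous_finsetSum _ (fun w _ => continuous_chi _)

lemma norm_gBad_le (ω) : ‖gBad n N ω‖ ≤ (badW n N).card := by
  unfold gBad
  refine (norm_sum_le _ _).trans ?_
  simp [norm_chi]

lemma integrable_chi (c : Fin N → Fin N → ℤ) : Integrable (chi c) (phaseMeasure N) :=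
  integrable_bdd _ _ (continuous_chi _) 1 (fun ω => (norm_chi _ _).le)

lemma integrable_gBad : Integrable (gBad n N) (phaseMeasure N) :=
  integrable_bdd _ _ continuous_gBad _ norm_gBad_le

lemma centered_eq (hn : 3 ≤ n) (hN : 3 ≤ N) (ω : Fin N → Fin N → ℝ) :
    centeredChebTrace N n ω = Ft N n ω +
      (1 / (2 * sN N ^ n)) * (gBad n N ω - ∫ ω', gBad n N ω' ∂(phaseMeasure N)).re := by
  unfold centeredChebTrace
  simp only [chebTrace_eq hn hN]
  have i1 : Integrable (fun ω => ∑ w ∈ injW n N, chi (wc w) ω) (phaseMeasure N) :=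
    integrable_finsetSum _ (fun w _ => integrable_chi _)
  have i2 : Integrable (fun ω => ∑ w ∈ injW n N, chi (wc w) ω + gBad n N ω) (phaseMeasure N) :=
    i1.add integrable_gBad
  rw [integral_const_mul, integral_sub i2 (integrable_const _), integral_add i1 integrable_gBad,
    integral_finsetSum _ (fun w _ => integrable_chi _)]
  have h0 : ∑ w ∈ injW n N, ∫ ω, chi (wc w) ω ∂(phaseMeasure N) = 0 := by
    apply Finset.sum_eq_zero
    intro w hw
    rw [integral_chi, if_neg]
    exact wc_ne_zero hn w (by simpa [injW] using hw)
  rw [h0]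
  have e : (1 / (2 * (sN N : ℂ) ^ n)) = ((1 / (2 * sN N ^ n) : ℝ) : ℂ) := by push_cast; rfl
  rw [e, ← mul_sub, Complex.re_ofReal_mul]
  unfold Ft
  rw [← mul_add]
  congr 1
  simp [chi_re]
  ring

lemma pairs_card (hn : 3 ≤ n) :
    (((badW n N) ×ˢ (badW n N)).filter (fun p => wc p.1 = wc p.2)).card ≤ (n - 1) ^ (n + n) * N ^ (n - 1) := by
  classical
  let e : (ZMod n → Fin N) × (ZMod n → Fin N) → (ZMod n ⊕ ZMod n → Fin N) := fun p => Sum.elim p.1 p.2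
  have he : Function.Injective e := by
    rintro ⟨a, b⟩ ⟨c, d⟩ h
    have := Sum.elim_eq_iff.1 h
    exact Prod.ext this.1 this.2
  rw [← Finset.card_image_of_injective _ he]
  have := card_few_values (ZMod n ⊕ ZMod n) N (n - 1)
    ((((badW n N) ×ˢ (badW n N)).filter (fun p => wc p.1 = wc p.2)).image e) (by
      intro x hx
      obtain ⟨⟨w, w'⟩, hp, rfl⟩ := Finset.mem_image.1 hx
      simp only [Finset.mem_filter, Finset.mem_product, badW, Finset.mem_univ, true_and] at hp
      exact pair_count hn w w' hp.1.1.1 hp.1.2.1 hp.1.1.2 ((wc_eq_iff _ _).1 hp.2))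
  simpa [ZMod.card] using this

/-- From a count to a rate. -/
lemma rate_aux (hN : 3 ≤ N) (k j : ℕ) (hk : 1 ≤ k) (c K : ℕ) (hj : j = k - 1) (hc : c ≤ K * N ^ j) :
    Real.sqrt c / sN N ^ k ≤ Real.sqrt (K * 3 ^ k) / Real.sqrt N := by
  have hNpos : (0 : ℝ) < N := by exact_mod_cast (by omega : 0 < N)
  have hs := sN_pos hN
  have hs2 : Real.sqrt ((sN N ^ 2) ^ k) = sN N ^ k := by
    rw [← pow_mul, mul_comm, pow_mul, Real.sqrt_sq (by positivity)]
  rw [← hs2, ← Real.sqrt_div (by positivity), ← Real.sqrt_div (by positivity)]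
  apply Real.sqrt_le_sqrt
  rw [div_le_div_iff₀ (by positivity) hNpos]
  have h1 : (c : ℝ) ≤ K * N ^ j := by exact_mod_cast hc
  have h2 : (N : ℝ) ^ k ≤ (3 * sN N ^ 2) ^ k := pow_le_pow_left₀ hNpos.le (sN_ge hN) k
  calc (c : ℝ) * N ≤ K * N ^ j * N := by gcongr
    _ = K * N ^ k := by
        rw [mul_assoc, ← pow_succ, hj]; congr 2; omega
    _ ≤ K * (3 * sN N ^ 2) ^ k := by gcongr
    _ = _ := by rw [mul_pow]; ring

lemma integral_gBad (hn : 3 ≤ n) (hN : 3 ≤ N) :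
    (∫ ω, ‖gBad n N ω‖ ∂(phaseMeasure N)) / sN N ^ n
      ≤ Real.sqrt (((n - 1) ^ (n + n) : ℕ) * 3 ^ n) / Real.sqrt N := by
  classical
  refine le_trans ?_ (rate_aux hN n (n - 1) (by omega) _ _ rfl (pairs_card hn))
  apply div_le_div_of_nonneg_right _ (pow_pos (sN_pos hN) _).le
  have := l1_bound (badW n N) (fun _ => (1 : ℂ)) (fun w => wc w) 1 zero_le_one (by simp)
  simp only [one_mul] at this
  unfold gBad
  refine this.trans (le_of_eq ?_)
  congr!

lemma continuous_Ft : Continuous (Ft N n) := by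
  unfold Ft
  apply continuous_const.mul
  exact continuous_finsetSum _ (fun w _ => Real.continuous_cos.comp (continuous_cph _))

lemma approx_rate (hn : 3 ≤ n) (hN : 3 ≤ N) :
    ∫ ω, |centeredChebTrace N n ω - Ft N n ω| ∂(phaseMeasure N)
      ≤ Real.sqrt (((n - 1) ^ (n + n) : ℕ) * 3 ^ n) / Real.sqrt N := by
  refine le_trans ?_ (integral_gBad hn hN)
  have hs := pow_pos (sN_pos hN) n
  have h1 : ∀ ω, |centeredChebTrace N n ω - Ft N n ω|
      ≤ (1 / (2 * sN N ^ n)) * (‖gBad n N ω‖ + ∫ ω', ‖gBad n N ω'‖ ∂(phaseMeasure N)) := by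
    intro ω
    rw [centered_eq hn hN, add_sub_cancel_left, abs_mul, abs_of_pos (by positivity)]
    gcongr
    refine (Complex.abs_re_le_norm _).trans ((norm_sub_le _ _).trans ?_)
    gcongr
    exact norm_integral_le_integral_norm _
  have i1 : Integrable (fun ω => ‖gBad n N ω‖) (phaseMeasure N) := integrable_gBad.norm
  refine (integral_mono_of_nonneg (ae_of_all _ (fun ω => abs_nonneg _)) ((i1.add (integrable_const _)).const_mul _)
    (ae_of_all _ h1)).trans ?_
  rw [integral_const_mul]
  simp only [Pi.add_apply]
  rw [integral_add i1 (integrable_const _)]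
  simp
  apply le_of_eq
  field_simp
  ring

/-! #### The carré du champ -/

/-- partial derivatives of `Ft` -/
def dF (N n : ℕ) [NeZero n] (a b : Fin N) (ω : Fin N → Fin N → ℝ) : ℝ :=
  (1 / (2 * sN N ^ n)) * ∑ w ∈ injW n N, - ((wc w a b : ℝ) * Real.sin (cph (wc w) ω))

/-- carré du champ -/
def gam (N n m : ℕ) [NeZero n] [NeZero m] (ω : Fin N → Fin N → ℝ) : ℝ :=
  ∑ a, ∑ b, dF N n a b ω * dF N m a b ω

lemma sum_wc_chi (a b : Fin N) (ω) :
    ∑ w ∈ injW n N, (wc w a b : ℂ) * chi (wc w) ω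
      = Complex.I * ((∑ w ∈ injW n N, (wc w a b : ℝ) * Real.sin (cph (wc w) ω) : ℝ) : ℂ) := by
  have h : ∑ w ∈ injW n N, (wc w a b : ℝ) * Real.cos (cph (wc w) ω) = 0 := by
    have h1 : ∑ w ∈ injW n N, (wc w a b : ℝ) * Real.cos (cph (wc w) ω)
        = ∑ w ∈ injW n N, - ((wc w a b : ℝ) * Real.cos (cph (wc w) ω)) := by
      refine Finset.sum_nbij' (fun w j => w (-j)) (fun w j => w (-j)) ?_ ?_ ?_ ?_ ?_
      · intro w hw
        simp only [injW, Finset.mem_filter, Finset.mem_univ, true_and] at hw ⊢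
        exact hw.comp neg_injective
      · intro w hw
        simp only [injW, Finset.mem_filter, Finset.mem_univ, true_and] at hw ⊢
        exact hw.comp neg_injective
      · intro w _; simp
      · intro w _; simp
      · intro w _
        rw [wc_neg, cph_neg]
        simp
    rw [Finset.sum_neg_distrib] at h1
    linarith
  apply Complex.ext
  · simp [chi_re]
    simpa using h
  · simp only [Complex.im_sum, Complex.I_mul_im, Complex.ofReal_re]
    apply Finset.sum_congr rfl
    intro w _
    rw [← Complex.ofReal_intCast, Complex.im_ofReal_mul, chi_im]

lemma gam_eq (hN : 3 ≤ N) (ω) : ((gam N n m ω : ℝ) : ℂ) = (1 / (4 * sN N ^ n * sN N ^ m) : ℝ) *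
    ∑ p ∈ injW n N ×ˢ injW m N, (wip p.1 p.2 : ℂ) * chi (wc p.1 - wc p.2) ω := by
  have h1 : ∀ (k : ℕ) [NeZero k] (a b : Fin N), ((dF N k a b ω : ℝ) : ℂ)
      = ((1 / (2 * sN N ^ k) : ℝ) : ℂ) * (Complex.I * ∑ w ∈ injW k N, (wc w a b : ℂ) * chi (wc w) ω) := by
    intro k _ a b
    rw [sum_wc_chi, ← mul_assoc Complex.I, Complex.I_mul_I]
    simp [dF]
  have h2 : ∀ a b, ((dF N n a b ω * dF N m a b ω : ℝ) : ℂ) = (1 / (4 * sN N ^ n * sN N ^ m) : ℝ) *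
      ∑ p ∈ injW n N ×ˢ injW m N, ((wc p.1 a b * wc p.2 a b : ℤ) : ℂ) * chi (wc p.1 - wc p.2) ω := by
    intro a b
    have h3 : ((dF N m a b ω : ℝ) : ℂ) = (starRingEnd ℂ) ((dF N m a b ω : ℝ) : ℂ) := by
      rw [Complex.conj_ofReal]
    rw [Complex.ofReal_mul, h3, h1, h1, map_mul, map_mul, Complex.conj_I, Complex.conj_ofReal, map_sum]
    have h4 : ∀ A B C D : ℂ, A * (Complex.I * B) * (C * (-Complex.I * D)) = A * C * (B * D) := by
      intro A B C D
      linear_combination (- A * C * B * D) * Complex.I_mul_I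
    rw [h4, Finset.sum_mul_sum, Finset.sum_product]
    congr 1
    · rw [← Complex.ofReal_mul]
      congr 1
      have := sN_pos hN
      field_simp
      norm_num
    · apply Finset.sum_congr rfl
      intro w _
      apply Finset.sum_congr rfl
      intro w' _
      rw [← chi_mul_conj, map_mul]
      simp
      ring
  unfold gam
  rw [Complex.ofReal_sum]
  simp only [Complex.ofReal_sum, h2]
  simp only [← Finset.mul_sum]
  congr 1
  have e : ∀ a : Fin N, ∑ b, ∑ p ∈ injW n N ×ˢ injW m N, ((wc p.1 a b * wc p.2 a b : ℤ) : ℂ) * chi (wc p.1 - wc p.2) ω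
    = ∑ p ∈ injW n N ×ˢ injW m N, ∑ b, ((wc p.1 a b * wc p.2 a b : ℤ) : ℂ) * chi (wc p.1 - wc p.2) ω :=
    fun a => Finset.sum_comm
  simp only [e]
  rw [Finset.sum_comm]
  apply Finset.sum_congr rfl
  intro p _
  simp only [← Finset.sum_mul]
  congr 1
  simp [wip]

end
end

section
/-! ### Part 6: the carré du champ concentrates -/

lemma descFactorial_rate (n : ℕ) : ∃ C : ℝ, 0 ≤ C ∧ ∀ N : ℕ, 3 ≤ N →
    |(N.descFactorial n : ℝ) / ((N : ℝ) - 2) ^ n - 1| ≤ C / N := by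
  induction n with
  | zero => exact ⟨0, le_rfl, fun N hN => by simp⟩
  | succ n ih =>
    obtain ⟨C, hC, h⟩ := ih
    refine ⟨(1 + C) * (3 * (n + 2)) + C, by positivity, fun N hN => ?_⟩
    have hN3 : (3 : ℝ) ≤ N := by exact_mod_cast hN
    have hNp : (0 : ℝ) < N := by linarith
    have hq : (0 : ℝ) < (N : ℝ) - 2 := by linarith
    set a := (N.descFactorial n : ℝ) / ((N : ℝ) - 2) ^ n with ha
    set r := ((N - n : ℕ) : ℝ) / ((N : ℝ) - 2) with hr
    have e : (N.descFactorial (n + 1) : ℝ) / ((N : ℝ) - 2) ^ (n + 1) = a * r := by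
      rw [Nat.descFactorial_succ, ha, hr]
      push_cast
      rw [div_mul_div_comm, pow_succ]
      ring
    have h1 : |a - 1| ≤ C / N := h N hN
    have h2 : |r - 1| ≤ 3 * (n + 2) / N := by
      rcases le_or_gt n N with hn | hn
      · rw [hr, Nat.cast_sub hn]
        have : ((N : ℝ) - n) / (N - 2) - 1 = (2 - n) / (N - 2) := by field_simp; ring
        rw [this, abs_div, abs_of_pos hq, div_le_div_iff₀ hq hNp]
        have h3 : |(2 : ℝ) - n| ≤ n + 2 := by
          rw [abs_le]; constructor <;> have := Nat.cast_nonneg (α := ℝ) n <;> linarith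
        calc |(2 : ℝ) - n| * N ≤ (n + 2) * (3 * (N - 2)) := by
              gcongr
              linarith
          _ = _ := by ring
      · rw [hr, Nat.sub_eq_zero_of_le hn.le]
        have : (N : ℝ) < n := by exact_mod_cast hn
        simp
        rw [le_div_iff₀ hNp]
        linarith
    have h4 : |a| ≤ 1 + C := by
      have : |a| ≤ |a - 1| + 1 := by
        have := abs_add_le (a - 1) 1
        simpa using this
      have h5 : C / N ≤ C := div_le_self hC (by linarith)
      linarith
    rw [e]
    calc |a * r - 1| = |a * (r - 1) + (a - 1)| := by congr 1; ring
      _ ≤ |a| * |r - 1| + |a - 1| := by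
        refine (abs_add_le _ _).trans ?_
        rw [abs_mul]
      _ ≤ (1 + C) * (3 * (n + 2) / N) + C / N := by gcongr
      _ = _ := by ring

section
variable {N n m : ℕ} [NeZero n] [NeZero m]

lemma card_injW : (injW n N).card = N.descFactorial n := by
  classical
  unfold injW
  rw [← Fintype.card_subtype, Fintype.card_congr (Equiv.subtypeInjectiveEquivEmbedding _ _),
    Fintype.card_embedding_eq, Fintype.card_fin, ZMod.card]

lemma mem_injW (w : ZMod n → Fin N) : w ∈ injW n N ↔ Function.Injective w := by
  simp [injW]

open Classical in
/-- pairs of walks with the same flow -/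
def dPairs (N n m : ℕ) [NeZero n] [NeZero m] : Finset ((ZMod n → Fin N) × (ZMod m → Fin N)) :=
  (injW n N ×ˢ injW m N).filter (fun p => wc p.1 = wc p.2)

open Classical in
/-- pairs of walks with distinct flows which interact -/
def qPairs (N n m : ℕ) [NeZero n] [NeZero m] : Finset ((ZMod n → Fin N) × (ZMod m → Fin N)) :=
  (injW n N ×ˢ injW m N).filter (fun p => wc p.1 ≠ wc p.2 ∧ wip p.1 p.2 ≠ 0)

/-- the fluctuating part -/
def rem (N n m : ℕ) [NeZero n] [NeZero m] (ω : Fin N → Fin N → ℝ) : ℂ :=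
  ∑ p ∈ qPairs N n m, (wip p.1 p.2 : ℂ) * chi (wc p.1 - wc p.2) ω

lemma gam_split (hN : 3 ≤ N) (ω) : ((gam N n m ω : ℝ) : ℂ) = (1 / (4 * sN N ^ n * sN N ^ m) : ℝ) *
    (∑ p ∈ dPairs N n m, (wip p.1 p.2 : ℂ) + rem N n m ω) := by
  classical
  rw [gam_eq hN, ← Finset.sum_filter_add_sum_filter_not _ (fun p => wc p.1 = wc p.2)]
  congr 2
  · apply Finset.sum_congr
    · unfold dPairs; congr!
    · intro p hp
      simp only [dPairs, Finset.mem_filter] at hp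
      rw [hp.2]
      simp [chi, cph]
  · unfold rem
    symm
    apply Finset.sum_subset
    · intro p hp
      simp only [qPairs, Finset.mem_filter] at hp ⊢
      exact ⟨hp.1, hp.2.1⟩
    · intro p hp hp2
      simp only [qPairs, Finset.mem_filter, not_and, not_not] at hp hp2
      rw [hp2 hp.1 hp.2]
      simp

lemma dPairs_off (hn : 3 ≤ n) (hne : n ≠ m) : dPairs N n m = ∅ := by
  classical
  apply Finset.eq_empty_of_forall_notMem
  rintro ⟨w, w'⟩ hp
  simp only [dPairs, Finset.mem_filter, Finset.mem_product, mem_injW] at hp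
  obtain ⟨i, i', h⟩ := follow_of_wflow_eq hn w w' hp.1.1 hp.1.2 ((wc_eq_iff _ _).1 hp.2)
  exact hne (follow_len w w' hp.1.1 hp.1.2 i i' h)

lemma dPairs_diag (hn : 3 ≤ n) : ∑ p ∈ dPairs N n n, (wip p.1 p.2 : ℂ) = (n : ℂ) ^ 2 * N.descFactorial n := by
  classical
  have h1 : ∑ p ∈ dPairs N n n, (wip p.1 p.2 : ℂ) = ∑ p ∈ dPairs N n n, (n : ℂ) := by
    apply Finset.sum_congr rfl
    rintro ⟨w, w'⟩ hp
    simp only [dPairs, Finset.mem_filter, Finset.mem_product, mem_injW] at hp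
    have : wip w w' = wip w w := by simp [wip, hp.2]
    simp only
    rw [this, wip_self hn w hp.1.1]
    simp
  have h2 : (dPairs N n n).card = N.descFactorial n * n := by
    have h3 : (injW n N ×ˢ (Finset.univ : Finset (ZMod n))).card = N.descFactorial n * n := by
      rw [Finset.card_product, card_injW, Finset.card_univ, ZMod.card]
    rw [← h3]
    symm
    refine Finset.card_bij (fun p _ => (p.1, fun j => p.1 (j + p.2))) ?_ ?_ ?_
    · rintro ⟨w, r⟩ hp
      simp only [Finset.mem_product, mem_injW, Finset.mem_univ, and_true] at hp
      simp only [dPairs, Finset.mem_filter, Finset.mem_product, mem_injW]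
      refine ⟨⟨hp, hp.comp (add_left_injective r)⟩, ?_⟩
      rw [wc_eq_iff, wflow_rot]
    · rintro ⟨w, r⟩ hp ⟨w', r'⟩ hp' h
      simp only [Finset.mem_product, mem_injW, Finset.mem_univ, and_true] at hp
      simp only [Prod.mk.injEq] at h ⊢
      obtain ⟨rfl, h⟩ := h
      refine ⟨rfl, ?_⟩
      have := congrFun h 0
      simpa using hp this
    · rintro ⟨w, w'⟩ hp
      simp only [dPairs, Finset.mem_filter, Finset.mem_product, mem_injW] at hp
      obtain ⟨i, i', h⟩ := follow_of_wflow_eq hn w w' hp.1.1 hp.1.2 ((wc_eq_iff _ _).1 hp.2)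
      refine ⟨(w, i - i'), by simp [mem_injW, hp.1.1], ?_⟩
      simp only [Prod.mk.injEq, true_and]
      exact (follow_rot w w' i i' h).symm
  rw [h1, Finset.sum_const, h2]
  simp
  ring

lemma quads_card (hn : 3 ≤ n) (hm : 3 ≤ m) :
    (((qPairs N n m) ×ˢ (qPairs N n m)).filter
      (fun p => wc p.1.1 - wc p.1.2 = wc p.2.1 - wc p.2.2)).card
      ≤ (n + m - 1) ^ (n + m + (n + m)) * N ^ (n + m - 1) := by
  classical
  let e : ((ZMod n → Fin N) × (ZMod m → Fin N)) × ((ZMod n → Fin N) × (ZMod m → Fin N)) →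
      ((ZMod n ⊕ ZMod m) ⊕ (ZMod n ⊕ ZMod m) → Fin N) :=
    fun p => Sum.elim (Sum.elim p.1.1 p.1.2) (Sum.elim p.2.1 p.2.2)
  have he : Function.Injective e := by
    rintro ⟨⟨a, b⟩, ⟨c, d⟩⟩ ⟨⟨a', b'⟩, ⟨c', d'⟩⟩ h
    have h1 := Sum.elim_eq_iff.1 h
    have h2 := Sum.elim_eq_iff.1 h1.1
    have h3 := Sum.elim_eq_iff.1 h1.2
    exact Prod.ext (Prod.ext h2.1 h2.2) (Prod.ext h3.1 h3.2)
  rw [← Finset.card_image_of_injective _ he]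
  have := card_few_values ((ZMod n ⊕ ZMod m) ⊕ (ZMod n ⊕ ZMod m)) N (n + m - 1)
    ((((qPairs N n m) ×ˢ (qPairs N n m)).filter
      (fun p => wc p.1.1 - wc p.1.2 = wc p.2.1 - wc p.2.2)).image e) (by
      intro x hx
      obtain ⟨⟨⟨w, w'⟩, ⟨w2, w2'⟩⟩, hp, rfl⟩ := Finset.mem_image.1 hx
      simp only [Finset.mem_filter, Finset.mem_product, qPairs, mem_injW] at hp
      obtain ⟨⟨⟨⟨a1, a2⟩, a3, a4⟩, ⟨b1, b2⟩, b3, b4⟩, c⟩ := hp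
      exact quad_count hn hm w w2 w' w2' a1 a2 b1 b2 (wip_meet _ _ a4)
        (fun h => a3 ((wc_eq_iff _ _).2 h)) (wc_sub_iff _ _ _ _ c))
  simpa [ZMod.card] using this

lemma rem_rate (hn : 3 ≤ n) (hm : 3 ≤ m) (hN : 3 ≤ N) :
    (∫ ω, ‖rem N n m ω‖ ∂(phaseMeasure N)) / (sN N ^ n * sN N ^ m)
      ≤ n * m * (Real.sqrt (((n + m - 1) ^ (n + m + (n + m)) : ℕ) * 3 ^ (n + m)) / Real.sqrt N) := by
  classical
  have h1 := rate_aux hN (n + m) (n + m - 1) (by omega) _ _ rfl (quads_card hn hm)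
  have h2 := l1_bound (qPairs N n m) (fun p => (wip p.1 p.2 : ℂ)) (fun p => wc p.1 - wc p.2) (n * m)
    (by positivity) (by
      intro p _
      rw [Complex.norm_intCast]
      exact_mod_cast abs_wip_le p.1 p.2)
  rw [← pow_add]
  have hs := pow_pos (sN_pos hN) (n + m)
  calc _ ≤ (n * m * Real.sqrt (((qPairs N n m) ×ˢ (qPairs N n m)).filter
      (fun p => wc p.1.1 - wc p.1.2 = wc p.2.1 - wc p.2.2)).card) / sN N ^ (n + m) := by
        apply div_le_div_of_nonneg_right _ hs.le
        refine h2.trans (le_of_eq ?_)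
        congr!
    _ ≤ _ := by
        rw [mul_div_assoc]
        gcongr
        

lemma continuous_rem : Continuous (rem N n m) := by
  unfold rem
  exact continuous_finsetSum _ (fun w _ => continuous_const.mul (continuous_chi _))

lemma integrable_rem : Integrable (rem N n m) (phaseMeasure N) := by
  unfold rem
  exact integrable_finsetSum _ (fun w _ => (integrable_chi _).const_mul _)

lemma continuous_dF (a b : Fin N) : Continuous (dF N n a b) := by
  unfold dF
  apply continuous_const.mul
  exact continuous_finsetSum _ (fun w _ => (continuous_const.mul (Real.continuous_sin.comp (continuous_cph _))).neg)

lemma continuous_gam : Continuous (gam N n m) := by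
  unfold gam
  exact continuous_finsetSum _ (fun a _ => continuous_finsetSum _ (fun b _ => (continuous_dF a b).mul (continuous_dF a b)))

end

lemma gam_dev {N n m : ℕ} [NeZero n] [NeZero m] (hn : 3 ≤ n) (hm : 3 ≤ m) (hN : 3 ≤ N) (A B : ℝ) (hA : A = (if n = m then (n : ℝ) / 4 else 0))
    (hB : |(N.descFactorial n : ℝ) / ((N : ℝ) - 2) ^ n - 1| ≤ B) (hB0 : 0 ≤ B) (ω) :
    |gam N n m ω / n - A| ≤ n * B + ‖rem N n m ω‖ / (sN N ^ n * sN N ^ m) := by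
  have hs := sN_pos hN
  have hn0 : (1 : ℝ) ≤ n := by exact_mod_cast (by omega : 1 ≤ n)
  have hd : ∃ D : ℝ, ∑ p ∈ dPairs N n m, (wip p.1 p.2 : ℂ) = (D : ℂ) ∧
      |(1 / (4 * sN N ^ n * sN N ^ m)) * D / n - A| ≤ n * B := by
    by_cases h : n = m
    · subst h
      refine ⟨(n : ℝ) ^ 2 * N.descFactorial n, ?_, ?_⟩
      · have := dPairs_diag (N := N) hn
        simpa using this
      · rw [hA, if_pos rfl]
        have e : sN N ^ n * sN N ^ n = ((N : ℝ) - 2) ^ n := by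
          rw [← sN_sq hN, ← mul_pow, sq]
        have e2 : (1 / (4 * sN N ^ n * sN N ^ n)) * ((n : ℝ) ^ 2 * N.descFactorial n) / n - n / 4
            = (n / 4) * ((N.descFactorial n : ℝ) / ((N : ℝ) - 2) ^ n - 1) := by
          rw [← e]
          field_simp
        rw [e2, abs_mul, abs_of_pos (by positivity)]
        gcongr
        linarith
    · refine ⟨0, ?_, ?_⟩
      · rw [dPairs_off hn h]; simp
      · rw [hA, if_neg h]; simp; positivity
  obtain ⟨D, hD, hD2⟩ := hd
  have h1 : gam N n m ω = (1 / (4 * sN N ^ n * sN N ^ m)) * (D + (rem N n m ω).re) := by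
    have := congrArg Complex.re (gam_split (n := n) (m := m) hN ω)
    rw [hD, Complex.re_ofReal_mul] at this
    simpa using this
  have h2 : gam N n m ω / n - A = ((1 / (4 * sN N ^ n * sN N ^ m)) * D / n - A)
      + (1 / (4 * n)) * ((rem N n m ω).re / (sN N ^ n * sN N ^ m)) := by
    rw [h1]
    field_simp
    ring
  rw [h2]
  refine (abs_add_le _ _).trans (add_le_add hD2 ?_)
  rw [abs_mul, abs_of_pos (by positivity : (0 : ℝ) < 1 / (4 * n)), abs_div,
    abs_of_pos (by positivity : (0 : ℝ) < sN N ^ n * sN N ^ m)]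
  calc _ ≤ 1 * (‖rem N n m ω‖ / (sN N ^ n * sN N ^ m)) := by
        gcongr
        · rw [div_le_one (by positivity)]; linarith
        · exact Complex.abs_re_le_norm _
    _ = _ := one_mul _

theorem gam_rate (n m : ℕ) [NeZero n] [NeZero m] (hn : 3 ≤ n) (hm : 3 ≤ m) :
    ∃ C : ℝ, 0 ≤ C ∧ ∀ N : ℕ, 3 ≤ N →
      ∫ ω, |gam N n m ω / n - (if n = m then (n : ℝ) / 4 else 0)| ∂(phaseMeasure N) ≤ C / Real.sqrt N := by
  obtain ⟨C, hC, h⟩ := descFactorial_rate n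
  refine ⟨n * C + n * m * Real.sqrt (((n + m - 1) ^ (n + m + (n + m)) : ℕ) * 3 ^ (n + m)), by positivity, fun N hN => ?_⟩
  have hN3 : (3 : ℝ) ≤ N := by exact_mod_cast hN
  have i1 : Integrable (fun ω => ‖rem N n m ω‖ / (sN N ^ n * sN N ^ m)) (phaseMeasure N) :=
    integrable_rem.norm.div_const _
  refine (integral_mono_of_nonneg (ae_of_all _ (fun ω => abs_nonneg _)) ((integrable_const (n * (C / N))).add i1)
    (ae_of_all _ (fun ω => gam_dev hn hm hN _ (C / N) rfl (h N hN) (by positivity) ω))).trans ?_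
  simp only [Pi.add_apply]
  rw [integral_add (integrable_const _) i1, integral_div]
  have h3 := rem_rate (N := N) hn hm hN
  simp only [integral_const, probReal_univ, one_smul]
  have h4 : C / N ≤ C / Real.sqrt N := by
    have : Real.sqrt N ≤ N := by
      rw [Real.sqrt_le_left (by linarith)]
      nlinarith
    have h5 : 0 < Real.sqrt N := Real.sqrt_pos.2 (by linarith)
    gcongr
  calc _ ≤ n * (C / Real.sqrt N) + n * m * (Real.sqrt (((n + m - 1) ^ (n + m + (n + m)) : ℕ) * 3 ^ (n + m)) / Real.sqrt N) := by
        gcongr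
    _ = _ := by ring

end

section
/-! ### Part 7: integration by parts in the phases -/

section
variable {ι : Type*} [Fintype ι] [DecidableEq ι] {α : ι → Type*} [∀ i, MeasurableSpace (α i)]
  (μ : ∀ i, Measure (α i)) [∀ i, IsProbabilityMeasure (μ i)]

/-- Resampling one coordinate preserves a product measure. -/
lemma update_mp (i : ι) :
    MeasurePreserving (fun p : (∀ j, α j) × α i => Function.update p.1 i p.2)
      ((Measure.pi μ).prod (μ i)) (Measure.pi μ) := by
  refine ⟨measurable_update', ?_⟩
  symm
  apply Measure.pi_eq
  intro s hs
  rw [Measure.map_apply measurable_update' (MeasurableSet.univ_pi hs)]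
  have h : (fun p : (∀ j, α j) × α i => Function.update p.1 i p.2) ⁻¹' (Set.univ.pi s)
      = (Set.univ.pi (Function.update s i Set.univ)) ×ˢ (s i) := by
    ext ⟨x, y⟩
    simp only [Set.mem_preimage, Set.mem_univ_pi, Set.mem_prod]
    constructor
    · intro h
      refine ⟨fun j => ?_, by simpa using h i⟩
      by_cases hj : j = i
      · subst hj; simp
      · simpa [hj] using h j
    · rintro ⟨h1, h2⟩ j
      by_cases hj : j = i
      · subst hj; simpa using h2
      · simpa [hj] using h1 j
  rw [h, Measure.prod_prod, Measure.pi_pi, ← Finset.mul_prod_erase _ _ (Finset.mem_univ i),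
    ← Finset.mul_prod_erase _ (fun j => (μ j) (s j)) (Finset.mem_univ i)]
  simp only [Function.update_self, measure_univ, one_mul]
  rw [mul_comm]
  congr 1
  apply Finset.prod_congr rfl
  intro j hj
  rw [Function.update_of_ne (Finset.ne_of_mem_erase hj)]

lemma integrable_update (i : ι) (f : (∀ j, α j) → ℝ) (hf : Integrable f (Measure.pi μ)) :
    Integrable (fun p : (∀ j, α j) × α i => f (Function.update p.1 i p.2)) ((Measure.pi μ).prod (μ i)) :=
  (update_mp μ i).integrable_comp_of_integrable hf

lemma integral_update (i : ι) (f : (∀ j, α j) → ℝ) (hf : Integrable f (Measure.pi μ)) :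
    ∫ x, f x ∂(Measure.pi μ) = ∫ x, ∫ y, f (Function.update x i y) ∂(μ i) ∂(Measure.pi μ) := by
  rw [← integral_prod (fun p : (∀ j, α j) × α i => f (Function.update p.1 i p.2)) (integrable_update μ i f hf)]
  have h := update_mp μ i
  conv_lhs => rw [← h.map_eq]
  rw [integral_map h.measurable.aemeasurable]
  rw [h.map_eq]
  exact hf.aestronglyMeasurable

end

section
variable {N : ℕ}

lemma pi_unif_ae {n : ℕ} : (Measure.pi (fun _ : Fin n => uniformPhase)) (Set.univ.pi fun _ => Set.Icc 0 (2 * Real.pi)) = 1 := by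
  rw [Measure.pi_pi]
  apply Finset.prod_eq_one
  intro i _
  apply le_antisymm prob_le_one
  have h : (0 : ℝ) < 2 * Real.pi := by positivity
  simp only [uniformPhase, Measure.smul_apply, smul_eq_mul]
  rw [Measure.restrict_apply measurableSet_Icc, Set.inter_eq_self_of_subset_right Set.Ico_subset_Icc_self,
    Real.volume_Ico, sub_zero, ENNReal.inv_mul_cancel (by simpa using h) ENNReal.ofReal_ne_top]

lemma integrable_phase (f : (Fin N → Fin N → ℝ) → ℝ) (hf : Continuous f) : Integrable f (phaseMeasure N) := by
  let K : Set (Fin N → Fin N → ℝ) := Set.univ.pi fun _ => Set.univ.pi fun _ => Set.Icc 0 (2 * Real.pi)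
  have hK : IsCompact K := isCompact_univ_pi fun _ => isCompact_univ_pi fun _ => isCompact_Icc
  have hK1 : phaseMeasure N K = 1 := by
    unfold phaseMeasure
    rw [Measure.pi_pi]
    exact Finset.prod_eq_one (fun i _ => pi_unif_ae)
  obtain ⟨C, hC⟩ := hK.exists_bound_of_continuousOn hf.continuousOn
  have hae : ∀ᵐ ω ∂(phaseMeasure N), ω ∈ K := by
    rw [ae_iff]
    exact (prob_compl_eq_zero_iff hK.isClosed.measurableSet).2 hK1
  refine Integrable.of_bound hf.aestronglyMeasurable C ?_
  filter_upwards [hae] with ω hω using hC ω hω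

/-- change one phase -/
def upd (a b : Fin N) (ω : Fin N → Fin N → ℝ) (x : ℝ) : Fin N → Fin N → ℝ :=
  Function.update ω a (Function.update (ω a) b x)

lemma integral_phase_upd (a b : Fin N) (f : (Fin N → Fin N → ℝ) → ℝ) (hf : Continuous f)
    (h : ∀ ω, ∫ x, f (upd a b ω x) ∂uniformPhase = 0) :
    ∫ ω, f ω ∂(phaseMeasure N) = 0 := by
  have hi := integrable_phase f hf
  unfold phaseMeasure at hi ⊢
  rw [integral_update _ a f hi]
  have : ∀ ω : Fin N → Fin N → ℝ, ∫ y, f (Function.update ω a y) ∂(Measure.pi fun _ => uniformPhase) = 0 := by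
    intro ω
    have hc : Continuous (fun y : Fin N → ℝ => f (Function.update ω a y)) :=
      hf.comp (continuous_const.update a continuous_id)
    have hi2 : Integrable (fun y : Fin N → ℝ => f (Function.update ω a y)) (Measure.pi fun _ => uniformPhase) := by
      have hK : IsCompact (Set.univ.pi fun _ : Fin N => Set.Icc 0 (2 * Real.pi)) := isCompact_univ_pi fun _ => isCompact_Icc
      obtain ⟨C, hC⟩ := hK.exists_bound_of_continuousOn hc.continuousOn
      refine Integrable.of_bound hc.aestronglyMeasurable C ?_
      have hae : ∀ᵐ y ∂(Measure.pi fun _ : Fin N => uniformPhase), y ∈ (Set.univ.pi fun _ : Fin N => Set.Icc 0 (2 * Real.pi)) := by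
        rw [ae_iff]
        exact (prob_compl_eq_zero_iff hK.isClosed.measurableSet).2 pi_unif_ae
      filter_upwards [hae] with y hy using hC y hy
    rw [integral_update _ b _ hi2]
    have h2 : ∀ y : Fin N → ℝ, ∫ x, f (Function.update ω a (Function.update y b x)) ∂uniformPhase = 0 := by
      intro y
      have := h (Function.update ω a y)
      simpa [upd] using this
    simp [h2]
  simp [this]

lemma phase_ibp (a b : Fin N) (G G' : (Fin N → Fin N → ℝ) → ℝ) (hG' : Continuous G')
    (hd : ∀ ω x, HasDerivAt (fun x => G (upd a b ω x)) (G' (upd a b ω x)) x)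
    (hp : ∀ ω, G (upd a b ω (2 * Real.pi)) = G (upd a b ω 0)) :
    ∫ ω, G' ω ∂(phaseMeasure N) = 0 := by
  apply integral_phase_upd a b G' hG'
  intro ω
  rw [integral_uniformPhase]
  have hc : Continuous (fun x => G' (upd a b ω x)) :=
    hG'.comp (continuous_const.update a (continuous_const.update b continuous_id))
  rw [intervalIntegral.integral_eq_sub_of_hasDerivAt (fun x _ => hd ω x) (hc.intervalIntegrable _ _), hp]
  simp

lemma cph_upd (c : Fin N → Fin N → ℤ) (a b : Fin N) (ω) (x : ℝ) :
    cph c (upd a b ω x) = cph c (upd a b ω 0) + c a b * x := by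
  unfold cph
  have h : ∀ a' b', upd a b ω x a' b' = upd a b ω 0 a' b' + if a' = a then (if b' = b then x else 0) else 0 := by
    intro a' b'
    unfold upd
    by_cases h1 : a' = a
    · subst h1
      by_cases h2 : b' = b
      · subst h2; simp
      · simp [h2]
    · simp [h1]
  simp only [h, mul_add, Finset.sum_add_distrib]
  simp

lemma hasDerivAt_cph (c : Fin N → Fin N → ℤ) (a b : Fin N) (ω) (x : ℝ) :
    HasDerivAt (fun x => cph c (upd a b ω x)) (c a b) x := by
  have h : (fun x => cph c (upd a b ω x)) = fun x => cph c (upd a b ω 0) + c a b * x := by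
    ext x; rw [cph_upd]
  rw [h]
  simpa using ((hasDerivAt_id x).const_mul (c a b : ℝ)).const_add (cph c (upd a b ω 0))

variable {n m : ℕ} [NeZero n] [NeZero m]

/-- second partial derivatives of `Ft` -/
def ddF (N n : ℕ) [NeZero n] (a b : Fin N) (ω : Fin N → Fin N → ℝ) : ℝ :=
  (1 / (2 * sN N ^ n)) * ∑ w ∈ injW n N, - ((wc w a b : ℝ) * ((wc w a b : ℝ) * Real.cos (cph (wc w) ω)))

lemma continuous_ddF (a b : Fin N) : Continuous (ddF N n a b) := by
  unfold ddF
  apply continuous_const.mul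
  exact continuous_finsetSum _ (fun w _ => (continuous_const.mul (continuous_const.mul (Real.continuous_cos.comp (continuous_cph _)))).neg)

lemma hasDerivAt_Ft (a b : Fin N) (ω) (x : ℝ) :
    HasDerivAt (fun x => Ft N n (upd a b ω x)) (dF N n a b (upd a b ω x)) x := by
  unfold Ft dF
  apply HasDerivAt.const_mul
  apply HasDerivAt.fun_sum
  intro w _
  refine (hasDerivAt_cph (wc w) a b ω x).cos.congr_deriv ?_
  ring

lemma hasDerivAt_dF (a b : Fin N) (ω) (x : ℝ) :
    HasDerivAt (fun x => dF N n a b (upd a b ω x)) (ddF N n a b (upd a b ω x)) x := by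
  unfold dF ddF
  apply HasDerivAt.const_mul
  apply HasDerivAt.fun_sum
  intro w _
  refine ((hasDerivAt_cph (wc w) a b ω x).sin.const_mul (wc w a b : ℝ)).fun_neg.congr_deriv ?_
  ring

lemma cos_period (c : Fin N → Fin N → ℤ) (a b : Fin N) (ω) :
    Real.cos (cph c (upd a b ω (2 * Real.pi))) = Real.cos (cph c (upd a b ω 0)) := by
  rw [cph_upd, Real.cos_add_int_mul_two_pi]

lemma sin_period (c : Fin N → Fin N → ℤ) (a b : Fin N) (ω) :
    Real.sin (cph c (upd a b ω (2 * Real.pi))) = Real.sin (cph c (upd a b ω 0)) := by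
  rw [cph_upd, Real.sin_add_int_mul_two_pi]

lemma sum_ddF (hn : 3 ≤ n) (ω) : ∑ a, ∑ b, ddF N n a b ω = - (n * Ft N n ω) := by
  unfold ddF Ft
  simp only [← Finset.mul_sum]
  have h : ∀ w ∈ injW n N, ∑ a, ∑ b, - ((wc w a b : ℝ) * ((wc w a b : ℝ) * Real.cos (cph (wc w) ω)))
      = - (n * Real.cos (cph (wc w) ω)) := by
    intro w hw
    have h1 := wip_self hn w ((mem_injW w).1 hw)
    have h2 : (∑ a, ∑ b, (wc w a b : ℝ) * (wc w a b : ℝ)) = n := by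
      have := congrArg (fun z : ℤ => (z : ℝ)) h1
      simpa [wip] using this
    rw [← h2]
    simp only [Finset.sum_neg_distrib, Finset.sum_mul, mul_assoc]
  have h3 : ∀ a : Fin N, ∑ b, ∑ w ∈ injW n N, - ((wc w a b : ℝ) * ((wc w a b : ℝ) * Real.cos (cph (wc w) ω)))
      = ∑ w ∈ injW n N, ∑ b, - ((wc w a b : ℝ) * ((wc w a b : ℝ) * Real.cos (cph (wc w) ω))) :=
    fun a => Finset.sum_comm
  simp only [h3]
  rw [Finset.sum_comm, Finset.sum_congr rfl h, Finset.sum_neg_distrib, ← Finset.mul_sum]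
  ring

end

/-- expansion of a derivative in coordinates -/
lemma clm_expand {d : ℕ} (L : (Fin d → ℝ) →L[ℝ] ℝ) (v : Fin d → ℝ) :
    L v = ∑ j, v j * L (Pi.single j 1) := by
  conv_lhs => rw [← Finset.univ_sum_single v]
  rw [map_sum]
  apply Finset.sum_congr rfl
  intro j _
  have : (Pi.single j (v j) : Fin d → ℝ) = v j • Pi.single j 1 := by
    rw [← Pi.single_smul]; simp
  rw [this, map_smul, smul_eq_mul]

theorem phase_stein {d : ℕ} (ν : Fin d → ℕ) [∀ i, NeZero (ν i)] (hν : ∀ i, 3 ≤ ν i) (N : ℕ)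
    (g : (Fin d → ℝ) → ℝ) (hg : ContDiff ℝ 1 g) (i : Fin d) :
    ∫ ω, Ft N (ν i) ω * g (fun j => Ft N (ν j) ω) ∂(phaseMeasure N)
      = ∑ j, ∫ ω, (gam N (ν i) (ν j) ω / ν i) * fderiv ℝ g (fun j => Ft N (ν j) ω) (Pi.single j 1) ∂(phaseMeasure N) := by
  set F : (Fin N → Fin N → ℝ) → (Fin d → ℝ) := fun ω j => Ft N (ν j) ω with hF
  have hFc : Continuous F := continuous_pi fun j => continuous_Ft
  have hgc : Continuous (fun ω => g (F ω)) := hg.continuous.comp hFc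
  have hg'c : ∀ j : Fin d, Continuous (fun ω => fderiv ℝ g (F ω) (Pi.single j 1)) := fun j =>
    ((hg.continuous_fderiv (by norm_num)).comp hFc).clm_apply continuous_const
  have key : ∀ a b : Fin N, ∫ ω, (ddF N (ν i) a b ω * g (F ω) + ∑ j, dF N (ν i) a b ω * dF N (ν j) a b ω * fderiv ℝ g (F ω) (Pi.single j 1)) ∂(phaseMeasure N) = 0 := by
    intro a b
    apply phase_ibp a b (fun ω => dF N (ν i) a b ω * g (F ω))
    · refine ((continuous_ddF a b).mul hgc).add (continuous_finsetSum _ fun j _ => ?_)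
      exact ((continuous_dF a b).mul (continuous_dF a b)).mul (hg'c j)
    · intro ω x
      have h1 : HasDerivAt (fun x => F (upd a b ω x)) (fun j => dF N (ν j) a b (upd a b ω x)) x :=
        hasDerivAt_pi.2 (fun j => hasDerivAt_Ft a b ω x)
      have h2 := ((hg.differentiable (by norm_num)) (F (upd a b ω x))).hasFDerivAt.comp_hasDerivAt x h1
      have h3 := (hasDerivAt_dF (n := ν i) a b ω x).mul h2
      refine HasDerivAt.congr_deriv h3 ?_
      rw [clm_expand (fderiv ℝ g (F (upd a b ω x))), Finset.mul_sum]
      simp only [mul_assoc, Function.comp]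
    · intro ω
      have hFp : F (upd a b ω (2 * Real.pi)) = F (upd a b ω 0) := by
        ext j
        simp only [hF, Ft, cos_period]
      simp only [hFp, dF, sin_period]
  have hsum : ∫ ω, (∑ a, ∑ b, (ddF N (ν i) a b ω * g (F ω) + ∑ j, dF N (ν i) a b ω * dF N (ν j) a b ω * fderiv ℝ g (F ω) (Pi.single j 1))) ∂(phaseMeasure N) = 0 := by
    have hc : ∀ a b : Fin N, Continuous (fun ω => ddF N (ν i) a b ω * g (F ω) + ∑ j, dF N (ν i) a b ω * dF N (ν j) a b ω * fderiv ℝ g (F ω) (Pi.single j 1)) := by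
      intro a b
      refine ((continuous_ddF a b).mul hgc).add (continuous_finsetSum _ fun j _ => ?_)
      exact ((continuous_dF a b).mul (continuous_dF a b)).mul (hg'c j)
    rw [integral_finsetSum _ (fun a _ => integrable_phase _ (continuous_finsetSum _ fun b _ => hc a b))]
    apply Finset.sum_eq_zero
    intro a _
    rw [integral_finsetSum _ (fun b _ => integrable_phase _ (hc a b))]
    exact Finset.sum_eq_zero fun b _ => key a b
  have hpt : ∀ ω, (∑ a, ∑ b, (ddF N (ν i) a b ω * g (F ω) + ∑ j, dF N (ν i) a b ω * dF N (ν j) a b ω * fderiv ℝ g (F ω) (Pi.single j 1)))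
      = - (ν i * (Ft N (ν i) ω * g (F ω))) + ∑ j, gam N (ν i) (ν j) ω * fderiv ℝ g (F ω) (Pi.single j 1) := by
    intro ω
    simp only [Finset.sum_add_distrib, ← Finset.sum_mul]
    rw [sum_ddF (hν i)]
    congr 1
    · ring
    · unfold gam
      have : ∀ a : Fin N, ∑ b, ∑ j, dF N (ν i) a b ω * dF N (ν j) a b ω * fderiv ℝ g (F ω) (Pi.single j 1)
        = ∑ j, ∑ b, dF N (ν i) a b ω * dF N (ν j) a b ω * fderiv ℝ g (F ω) (Pi.single j 1) := fun a => Finset.sum_comm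
      simp only [this]
      rw [Finset.sum_comm]
      simp only [Finset.sum_mul]
  simp only [hpt] at hsum
  have i1 : Integrable (fun ω => - (ν i * (Ft N (ν i) ω * g (F ω)))) (phaseMeasure N) :=
    integrable_phase _ (continuous_const.mul (continuous_Ft.mul hgc)).neg
  have i2 : ∀ j, Integrable (fun ω => gam N (ν i) (ν j) ω * fderiv ℝ g (F ω) (Pi.single j 1)) (phaseMeasure N) :=
    fun j => integrable_phase _ (continuous_gam.mul (hg'c j))
  rw [integral_add i1 (integrable_finsetSum _ fun j _ => i2 j), integral_neg, integral_const_mul,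
    integral_finsetSum _ fun j _ => i2 j] at hsum
  have hi0 : (ν i : ℝ) ≠ 0 := by exact_mod_cast NeZero.ne (ν i)
  have e : ∀ j, ∫ ω, (gam N (ν i) (ν j) ω / ν i) * fderiv ℝ g (F ω) (Pi.single j 1) ∂(phaseMeasure N)
      = (∫ ω, gam N (ν i) (ν j) ω * fderiv ℝ g (F ω) (Pi.single j 1) ∂(phaseMeasure N)) / ν i := by
    intro j
    rw [← integral_div]
    congr 1
    ext ω
    ring
  rw [Finset.sum_congr rfl fun j _ => e j, ← Finset.sum_div, eq_div_iff hi0]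
  linarith

end

section
/-! ### Part 8: Stein's method -/

open scoped Convolution in
lemma lipschitz_convolution {d : ℕ} {E' F' : Type*} [NormedAddCommGroup E'] [NormedSpace ℝ E']
    [NormedAddCommGroup F'] [NormedSpace ℝ F']
    (L : E' →L[ℝ] ℝ →L[ℝ] F') (f : (Fin d → ℝ) → E') (hf : Continuous f) (hfc : HasCompactSupport f)
    (h : (Fin d → ℝ) → ℝ) (K : ℝ≥0) (hh : LipschitzWith K h) (x y : Fin d → ℝ) :
    ‖(f ⋆[L, volume] h) x - (f ⋆[L, volume] h) y‖ ≤ (‖L‖ * ∫ t, ‖f t‖) * K * ‖x - y‖ := by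
  have hli : LocallyIntegrable h volume := hh.continuous.locallyIntegrable
  have hx := (hfc.convolutionExists_left L hf hli x).integrable
  have hy := (hfc.convolutionExists_left L hf hli y).integrable
  unfold convolution
  rw [← integral_sub hx hy]
  have hi : Integrable (fun t => ‖f t‖) volume := (hf.integrable_of_hasCompactSupport hfc).norm
  have : ∀ t, ‖L (f t) (h (x - t)) - L (f t) (h (y - t))‖ ≤ ‖f t‖ * (‖L‖ * K * ‖x - y‖) := by
    intro t
    rw [← map_sub]
    refine (L.le_opNorm₂ _ _).trans ?_
    have h1 := hh.norm_sub_le (x - t) (y - t)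
    rw [sub_sub_sub_cancel_right] at h1
    calc _ ≤ ‖L‖ * ‖f t‖ * (K * ‖x - y‖) := by gcongr
      _ = _ := by ring
  refine (norm_integral_le_of_norm_le (hi.mul_const _) (ae_of_all _ this)).trans (le_of_eq ?_)
  rw [integral_mul_const]
  ring

open scoped Convolution in
lemma mollify {d : ℕ} (h : (Fin d → ℝ) → ℝ) (K : ℝ≥0) (hh : LipschitzWith K h) (ε : ℝ) (hε : 0 < ε) :
    ∃ g : (Fin d → ℝ) → ℝ, ContDiff ℝ 2 g ∧ (∀ x, |g x - h x| ≤ K * ε) ∧ LipschitzWith K g ∧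
      ∃ K' : ℝ≥0, LipschitzWith K' (fderiv ℝ g) := by
  let φ : ContDiffBump (0 : Fin d → ℝ) := ⟨ε / 2, ε, half_pos hε, half_lt_self hε⟩
  have hli : LocallyIntegrable h volume := hh.continuous.locallyIntegrable
  let L : ℝ →L[ℝ] ℝ →L[ℝ] ℝ := ContinuousLinearMap.lsmul ℝ ℝ
  let f := φ.normed volume
  have hfc : HasCompactSupport f := φ.hasCompactSupport_normed
  have hf : ContDiff ℝ 2 f := φ.contDiff_normed (n := 2)
  refine ⟨f ⋆[L, volume] h, ?_, ?_, ?_, ?_⟩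
  · exact hfc.contDiff_convolution_left (n := 2) L hf hli
  · intro x
    have := φ.dist_normed_convolution_le (μ := volume) (x₀ := x) (ε := K * ε) hli.aestronglyMeasurable (by
      intro y hy
      refine (hh.dist_le_mul y x).trans ?_
      have : dist y x ≤ ε := (Metric.mem_ball.1 hy).le
      gcongr)
    rwa [Real.dist_eq] at this
  · apply LipschitzWith.of_dist_le_mul
    intro x y
    rw [dist_eq_norm, dist_eq_norm]
    refine (lipschitz_convolution L f hf.continuous hfc h K hh x y).trans ?_
    have h1 : ∫ t, ‖f t‖ = 1 := by
      rw [← φ.integral_normed (μ := volume)]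
      congr 1
      ext t
      exact Real.norm_of_nonneg (φ.nonneg_normed t)
    have h2 : ‖L‖ ≤ 1 := ContinuousLinearMap.opNorm_lsmul_le
    rw [h1]
    calc ‖L‖ * 1 * K * ‖x - y‖ ≤ 1 * 1 * K * ‖x - y‖ := by gcongr
      _ = _ := by ring
  · have hd : ∀ x, fderiv ℝ (f ⋆[L, volume] h) x = (fderiv ℝ f ⋆[L.precompL (Fin d → ℝ), volume] h) x := fun x =>
      (hfc.hasFDerivAt_convolution_left L (hf.of_le (by norm_num)) hli x).fderiv
    have hex : ∃ c : ℝ, ∀ x y, ‖(fderiv ℝ f ⋆[L.precompL (Fin d → ℝ), volume] h) x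
        - (fderiv ℝ f ⋆[L.precompL (Fin d → ℝ), volume] h) y‖ ≤ c * ‖x - y‖ :=
      ⟨_, lipschitz_convolution (L.precompL (Fin d → ℝ)) (fderiv ℝ f)
        (hf.continuous_fderiv (by norm_num)) (hfc.fderiv ℝ) h K hh⟩
    obtain ⟨c, hc⟩ := hex
    refine ⟨c.toNNReal, ?_⟩
    apply LipschitzWith.of_dist_le_mul
    intro x y
    rw [dist_eq_norm, dist_eq_norm, hd, hd]
    refine (hc x y).trans ?_
    gcongr
    exact Real.le_coe_toNNReal c

open ProbabilityTheory

lemma integrable_id_gauss (v : ℝ≥0) : Integrable (fun x : ℝ => x) (gaussianReal 0 v) :=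
  memLp_one_iff_integrable.1 (memLp_id_gaussianReal 1)

lemma hasDerivAt_gpdf (v : ℝ≥0) (x : ℝ) :
    HasDerivAt (gaussianPDFReal 0 v) (- (x / v) * gaussianPDFReal 0 v x) x := by
  rw [gaussianPDFReal_def]
  by_cases hv : v = 0
  · subst hv; simp; exact hasDerivAt_const _ _
  have hv' : (v : ℝ) ≠ 0 := by exact_mod_cast hv
  have h1 : HasDerivAt (fun x : ℝ => -(x - 0) ^ 2 / (2 * v)) (- (x / v)) x := by
    have := (((hasDerivAt_id x).sub_const 0).pow 2).neg.div_const (2 * (v : ℝ))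
    refine HasDerivAt.congr_deriv this ?_
    simp
    field_simp
  refine (h1.exp.const_mul _).congr_deriv ?_
  ring

lemma gauss_ibp1 (v : ℝ≥0) (hv : v ≠ 0) (g g' : ℝ → ℝ) (hg : ∀ x, HasDerivAt g (g' x) x)
    (hg'm : Continuous g') (B B' : ℝ) (hB : ∀ x, |g x| ≤ B) (hB' : ∀ x, |g' x| ≤ B') :
    ∫ x, x * g x ∂(gaussianReal 0 v) = v * ∫ x, g' x ∂(gaussianReal 0 v) := by
  have hv' : (v : ℝ) ≠ 0 := by exact_mod_cast hv
  have hgc : Continuous g := continuous_iff_continuousAt.2 fun x => (hg x).continuousAt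
  have i0 : Integrable (gaussianPDFReal 0 v) := integrable_gaussianPDFReal 0 v
  have i1 : Integrable (fun x => x * gaussianPDFReal 0 v x) := by
    have := integrable_id_gauss v
    rw [gaussianReal_of_var_ne_zero _ hv, integrable_withDensity_iff_integrable_smul' (measurable_gaussianPDF _ _)
      (ae_of_all _ fun _ => gaussianPDF_lt_top)] at this
    simpa [mul_comm] using this
  have key := integral_mul_deriv_eq_deriv_mul_of_integrable (u := g) (v := gaussianPDFReal 0 v) (u' := g')
    (v' := fun x => - (x / v) * gaussianPDFReal 0 v x) (fun x _ => hg x) (fun x _ => hasDerivAt_gpdf v x) ?_ ?_ ?_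
  · rw [integral_gaussianReal_eq_integral_smul hv, integral_gaussianReal_eq_integral_smul hv]
    simp only [smul_eq_mul]
    have e1 : ∫ x, gaussianPDFReal 0 v x * (x * g x) = - (v * ∫ x, g x * (- (x / v) * gaussianPDFReal 0 v x)) := by
      rw [← integral_const_mul, ← integral_neg]
      congr 1
      ext x
      field_simp
    rw [e1, key, mul_neg, neg_neg]
    congr 2
    ext x
    ring
  · have : Integrable (fun x => g x * ((-(1 / v : ℝ)) * (x * gaussianPDFReal 0 v x))) :=
      (i1.const_mul _).bdd_mul (c := B) hgc.aestronglyMeasurable (ae_of_all _ hB)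
    refine this.congr (ae_of_all _ fun x => ?_)
    simp only [Pi.mul_apply]
    ring
  · exact i0.bdd_mul (c := B') hg'm.aestronglyMeasurable (ae_of_all _ hB')
  · exact i0.bdd_mul (c := B) hgc.aestronglyMeasurable (ae_of_all _ hB)

section
variable {d : ℕ} (v : Fin d → ℝ≥0)

/-- product Gaussian -/
abbrev gpi : Measure (Fin d → ℝ) := Measure.pi fun i => gaussianReal 0 (v i)

lemma integrable_coord (j : Fin d) : Integrable (fun z : Fin d → ℝ => z j) (gpi v) :=
  (measurePreserving_eval (fun i => gaussianReal 0 (v i)) j).integrable_comp_of_integrable (integrable_id_gauss (v j))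

lemma integral_abs_coord (j : Fin d) : ∫ z, |z j| ∂(gpi v) = ∫ x, |x| ∂(gaussianReal 0 (v j)) := by
  have h := measurePreserving_eval (fun i => gaussianReal 0 (v i)) j
  rw [← h.map_eq, integral_map h.measurable.aemeasurable]
  exact continuous_abs.aestronglyMeasurable

lemma gauss_ibp (hv : ∀ i, v i ≠ 0) (j : Fin d) (G : (Fin d → ℝ) → ℝ) (hG : ContDiff ℝ 1 G)
    (B B' : ℝ) (hB : ∀ x, |G x| ≤ B) (hB' : ∀ x, |fderiv ℝ G x (Pi.single j 1)| ≤ B') :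
    ∫ z, z j * G z ∂(gpi v) = v j * ∫ z, fderiv ℝ G z (Pi.single j 1) ∂(gpi v) := by
  have hGc := hG.continuous
  have hG'c : Continuous (fun z => fderiv ℝ G z (Pi.single j 1)) :=
    (hG.continuous_fderiv (by norm_num)).clm_apply continuous_const
  have i1 : Integrable (fun z : Fin d → ℝ => z j * G z) (gpi v) :=
    (integrable_coord v j).mul_bdd (c := B) hGc.aestronglyMeasurable (ae_of_all _ hB)
  have i2 : Integrable (fun z : Fin d → ℝ => fderiv ℝ G z (Pi.single j 1)) (gpi v) :=
    Integrable.of_bound hG'c.aestronglyMeasurable B' (ae_of_all _ hB')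
  unfold gpi
  rw [integral_update _ j _ i1, integral_update _ j _ i2, ← integral_const_mul]
  congr 1
  ext z
  simp only [Function.update_self]
  have hu : Continuous (fun x : ℝ => Function.update z j x) := continuous_const.update j continuous_id
  apply gauss_ibp1 (v j) (hv j) (fun x => G (Function.update z j x)) _ _ (hG'c.comp hu) B B' (fun x => hB _) (fun x => hB' _)
  intro x
  have h1 : HasDerivAt (fun x => Function.update z j x) (Pi.single j 1) x := hasDerivAt_update z j x
  exact ((hG.differentiable (by norm_num)) _).hasFDerivAt.comp_hasDerivAt x h1

end
end

section
/-! ### Part 9: comparison with the Gaussian -/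

open ProbabilityTheory

lemma norm_single_le {d : ℕ} (j : Fin d) : ‖(Pi.single j (1 : ℝ) : Fin d → ℝ)‖ ≤ 1 := by
  rw [pi_norm_le_iff_of_nonneg zero_le_one]
  intro i
  by_cases h : i = j
  · subst h; simp
  · simp [h]

lemma fderiv_affine {d : ℕ} (D : (Fin d → ℝ) → ℝ) (hD : ContDiff ℝ 1 D) (c : ℝ) (b x w : Fin d → ℝ) :
    fderiv ℝ (fun x => D (c • x + b)) x w = c * fderiv ℝ D (c • x + b) w := by
  have h1 : HasFDerivAt (fun x : Fin d → ℝ => c • x + b) (c • ContinuousLinearMap.id ℝ (Fin d → ℝ)) x :=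
    ((hasFDerivAt_id x).const_smul c).add_const b
  have h2 := ((hD.differentiable (by norm_num)) (c • x + b)).hasFDerivAt.comp x h1
  have h3 := h2.fderiv
  simp only [Function.comp_def] at h3
  rw [h3]
  simp

lemma contDiff_affine {d : ℕ} (D : (Fin d → ℝ) → ℝ) (hD : ContDiff ℝ 1 D) (c : ℝ) (b : Fin d → ℝ) :
    ContDiff ℝ 1 (fun x => D (c • x + b)) :=
  hD.comp ((contDiff_id.const_smul c).add contDiff_const)

section
variable {Ω : Type*} [MeasurableSpace Ω] {d : ℕ}

lemma meas_X (F : Ω → Fin d → ℝ) (hFm : Measurable F) (c s : ℝ) :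
    Measurable (fun p : Ω × (Fin d → ℝ) => c • F p.1 + s • p.2) :=
  ((hFm.comp measurable_fst).const_smul c).add (measurable_snd.const_smul s)

lemma stein_A (P : Measure Ω) [IsProbabilityMeasure P] (v : Fin d → ℝ≥0)
    (F : Ω → Fin d → ℝ) (hFm : Measurable F) (hFi : ∀ i, Integrable (fun ω => F ω i) P)
    (τ : Fin d → Fin d → Ω → ℝ) (hτ : ∀ i j, Integrable (τ i j) P)
    (hst : ∀ g : (Fin d → ℝ) → ℝ, ContDiff ℝ 1 g → ∀ i, ∫ ω, F ω i * g (F ω) ∂P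
      = ∑ j, ∫ ω, τ i j ω * fderiv ℝ g (F ω) (Pi.single j 1) ∂P)
    (D : (Fin d → ℝ) → ℝ) (hD : ContDiff ℝ 1 D) (B B' : ℝ) (hB : ∀ x, |D x| ≤ B)
    (hB' : ∀ j x, |fderiv ℝ D x (Pi.single j 1)| ≤ B') (c s : ℝ) (i : Fin d) :
    ∫ p, F p.1 i * D (c • F p.1 + s • p.2) ∂(P.prod (gpi v))
      = ∑ j, c * ∫ p, τ i j p.1 * fderiv ℝ D (c • F p.1 + s • p.2) (Pi.single j 1) ∂(P.prod (gpi v)) := by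
  have hX := meas_X F hFm c s
  have hHc : ∀ j, Continuous (fun z => fderiv ℝ D z (Pi.single j 1)) := fun j =>
    (hD.continuous_fderiv (by norm_num)).clm_apply continuous_const
  have i1 : Integrable (fun p : Ω × (Fin d → ℝ) => F p.1 i * D (c • F p.1 + s • p.2)) (P.prod (gpi v)) :=
    ((hFi i).comp_fst (gpi v)).mul_bdd (c := B) (hD.continuous.measurable.comp hX).aestronglyMeasurable
      (ae_of_all _ fun _ => hB _)
  have i2 : ∀ j, Integrable (fun p : Ω × (Fin d → ℝ) =>
      τ i j p.1 * fderiv ℝ D (c • F p.1 + s • p.2) (Pi.single j 1)) (P.prod (gpi v)) := fun j =>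
    ((hτ i j).comp_fst (gpi v)).mul_bdd (c := B') ((hHc j).measurable.comp hX).aestronglyMeasurable
      (ae_of_all _ fun _ => hB' j _)
  rw [integral_prod_symm _ i1]
  have e1 : ∀ z : Fin d → ℝ, ∫ ω, F ω i * D (c • F ω + s • z) ∂P
      = ∑ j, ∫ ω, c * (τ i j ω * fderiv ℝ D (c • F ω + s • z) (Pi.single j 1)) ∂P := by
    intro z
    have := hst (fun x => D (c • x + s • z)) (contDiff_affine D hD c _) i
    simp only [fderiv_affine D hD c (s • z)] at this
    rw [this]
    refine Finset.sum_congr rfl fun j _ => ?_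
    congr 1
    ext ω
    ring
  simp only [e1]
  rw [integral_finset_sum]
  · refine Finset.sum_congr rfl fun j _ => ?_
    rw [← integral_const_mul, integral_prod_symm _ ((i2 j).const_mul c)]
  · intro j _
    exact ((i2 j).const_mul c).integral_prod_right

lemma stein_B (P : Measure Ω) [IsProbabilityMeasure P] (v : Fin d → ℝ≥0) (hv : ∀ i, v i ≠ 0)
    (F : Ω → Fin d → ℝ) (hFm : Measurable F)
    (D : (Fin d → ℝ) → ℝ) (hD : ContDiff ℝ 1 D) (B B' : ℝ) (hB : ∀ x, |D x| ≤ B)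
    (hB' : ∀ j x, |fderiv ℝ D x (Pi.single j 1)| ≤ B') (c s : ℝ) (i : Fin d) :
    ∫ p, p.2 i * D (c • F p.1 + s • p.2) ∂(P.prod (gpi v))
      = v i * (s * ∫ p, fderiv ℝ D (c • F p.1 + s • p.2) (Pi.single i 1) ∂(P.prod (gpi v))) := by
  have hX := meas_X F hFm c s
  have hHc : ∀ j, Continuous (fun z => fderiv ℝ D z (Pi.single j 1)) := fun j =>
    (hD.continuous_fderiv (by norm_num)).clm_apply continuous_const
  have i1 : Integrable (fun p : Ω × (Fin d → ℝ) => p.2 i * D (c • F p.1 + s • p.2)) (P.prod (gpi v)) :=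
    ((integrable_coord v i).comp_snd P).mul_bdd (c := B) (hD.continuous.measurable.comp hX).aestronglyMeasurable
      (ae_of_all _ fun _ => hB _)
  have i2 : Integrable (fun p : Ω × (Fin d → ℝ) =>
      fderiv ℝ D (c • F p.1 + s • p.2) (Pi.single i 1)) (P.prod (gpi v)) :=
    Integrable.of_bound ((hHc i).measurable.comp hX).aestronglyMeasurable B'
      (ae_of_all _ fun _ => hB' i _)
  rw [integral_prod _ i1, integral_prod _ i2, ← integral_const_mul, ← integral_const_mul]
  congr 1
  ext ω
  have hg := gauss_ibp v hv i (fun z => D (s • z + c • F ω)) (contDiff_affine D hD s _) B (|s| * B')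
    (fun x => hB _) (fun x => by
      rw [fderiv_affine D hD, abs_mul]
      exact mul_le_mul_of_nonneg_left (hB' _ _) (abs_nonneg _))
  simp only [fderiv_affine D hD s (c • F ω), integral_const_mul] at hg
  simp only [add_comm (c • F ω)]
  exact hg

lemma stein_C (v : Fin d → ℝ≥0) (hv : ∀ i, v i ≠ 0)
    (D : (Fin d → ℝ) → ℝ) (hD : ContDiff ℝ 1 D) (B B' : ℝ) (hB : ∀ x, |D x| ≤ B)
    (hB' : ∀ j x, |fderiv ℝ D x (Pi.single j 1)| ≤ B') (s : ℝ) (a : Fin d → ℝ) (j : Fin d) :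
    |s * ∫ z, fderiv ℝ D (a + s • z) (Pi.single j 1) ∂(gpi v)|
      ≤ B * ((∫ x, |x| ∂(gaussianReal 0 (v j))) / v j) := by
  have hg := gauss_ibp v hv j (fun z => D (s • z + a)) (contDiff_affine D hD s _) B (|s| * B')
    (fun x => hB _) (fun x => by
      rw [fderiv_affine D hD, abs_mul]
      exact mul_le_mul_of_nonneg_left (hB' _ _) (abs_nonneg _))
  simp only [fderiv_affine D hD s a, integral_const_mul] at hg
  have hvp : (0 : ℝ) < v j := by
    have := pos_iff_ne_zero.2 (hv j)
    exact_mod_cast this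
  simp only [add_comm a]
  rw [← mul_div_assoc, le_div_iff₀ hvp, ← abs_of_pos hvp, ← abs_mul,
    mul_comm _ (v j : ℝ), ← hg, ← integral_abs_coord v j, ← integral_const_mul, ← Real.norm_eq_abs]
  refine norm_integral_le_of_norm_le ((integrable_coord v j).abs.const_mul B) (ae_of_all _ fun z => ?_)
  rw [Real.norm_eq_abs, abs_mul, mul_comm]
  exact mul_le_mul_of_nonneg_right (hB _) (abs_nonneg _)

lemma stein_E (P : Measure Ω) [IsProbabilityMeasure P] (v : Fin d → ℝ≥0) (hv : ∀ i, v i ≠ 0)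
    (F : Ω → Fin d → ℝ) (hFm : Measurable F)
    (ρ : Ω → ℝ) (hρ : Integrable ρ P)
    (D : (Fin d → ℝ) → ℝ) (hD : ContDiff ℝ 1 D) (B B' : ℝ) (hB : ∀ x, |D x| ≤ B)
    (hB' : ∀ j x, |fderiv ℝ D x (Pi.single j 1)| ≤ B') (c s : ℝ) (j : Fin d) :
    |s * ∫ p, ρ p.1 * fderiv ℝ D (c • F p.1 + s • p.2) (Pi.single j 1) ∂(P.prod (gpi v))|
      ≤ B * ((∫ x, |x| ∂(gaussianReal 0 (v j))) / v j) * ∫ ω, |ρ ω| ∂P := by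
  have hX := meas_X F hFm c s
  have hHc : ∀ j, Continuous (fun z => fderiv ℝ D z (Pi.single j 1)) := fun j =>
    (hD.continuous_fderiv (by norm_num)).clm_apply continuous_const
  have i2 : Integrable (fun p : Ω × (Fin d → ℝ) =>
      ρ p.1 * fderiv ℝ D (c • F p.1 + s • p.2) (Pi.single j 1)) (P.prod (gpi v)) :=
    (hρ.comp_fst (gpi v)).mul_bdd (c := B') ((hHc j).measurable.comp hX).aestronglyMeasurable
      (ae_of_all _ fun _ => hB' j _)
  rw [integral_prod _ i2]
  simp only [integral_const_mul]
  rw [← integral_const_mul, ← integral_const_mul, ← Real.norm_eq_abs]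
  refine norm_integral_le_of_norm_le (hρ.abs.const_mul _) (ae_of_all _ fun ω => ?_)
  rw [Real.norm_eq_abs, mul_left_comm, abs_mul, mul_comm]
  exact mul_le_mul_of_nonneg_right (stein_C v hv D hD B B' hB hB' s _ j) (abs_nonneg _)

lemma stein_bound (P : Measure Ω) [IsProbabilityMeasure P] (v : Fin d → ℝ≥0) (hv : ∀ i, v i ≠ 0)
    (F : Ω → Fin d → ℝ) (hFm : Measurable F) (hFi : ∀ i, Integrable (fun ω => F ω i) P)
    (τ : Fin d → Fin d → Ω → ℝ) (hτ : ∀ i j, Integrable (τ i j) P)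
    (hst : ∀ g : (Fin d → ℝ) → ℝ, ContDiff ℝ 1 g → ∀ i, ∫ ω, F ω i * g (F ω) ∂P
      = ∑ j, ∫ ω, τ i j ω * fderiv ℝ g (F ω) (Pi.single j 1) ∂P)
    (D : (Fin d → ℝ) → ℝ) (hD : ContDiff ℝ 1 D) (B B' : ℝ) (hB : ∀ x, |D x| ≤ B)
    (hB' : ∀ j x, |fderiv ℝ D x (Pi.single j 1)| ≤ B') (c s : ℝ) (hc : |c| ≤ 1) (i : Fin d) :
    |(∫ p, p.2 i * D (c • F p.1 + s • p.2) ∂(P.prod (gpi v))) * c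
      - (∫ p, F p.1 i * D (c • F p.1 + s • p.2) ∂(P.prod (gpi v))) * s|
      ≤ ∑ j, B * ((∫ x, |x| ∂(gaussianReal 0 (v j))) / v j)
          * ∫ ω, |τ i j ω - (if i = j then (v i : ℝ) else 0)| ∂P := by
  have hX := meas_X F hFm c s
  have hHc : ∀ j, Continuous (fun z => fderiv ℝ D z (Pi.single j 1)) := fun j =>
    (hD.continuous_fderiv (by norm_num)).clm_apply continuous_const
  have i1 : ∀ j, Integrable (fun p : Ω × (Fin d → ℝ) =>
      fderiv ℝ D (c • F p.1 + s • p.2) (Pi.single j 1)) (P.prod (gpi v)) := fun j =>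
    Integrable.of_bound ((hHc j).measurable.comp hX).aestronglyMeasurable B'
      (ae_of_all _ fun _ => hB' j _)
  have i2 : ∀ j, Integrable (fun p : Ω × (Fin d → ℝ) =>
      τ i j p.1 * fderiv ℝ D (c • F p.1 + s • p.2) (Pi.single j 1)) (P.prod (gpi v)) := fun j =>
    ((hτ i j).comp_fst (gpi v)).mul_bdd (c := B') ((hHc j).measurable.comp hX).aestronglyMeasurable
      (ae_of_all _ fun _ => hB' j _)
  rw [stein_A P v F hFm hFi τ hτ hst D hD B B' hB hB' c s i, stein_B P v hv F hFm D hD B B' hB hB' c s i]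
  have e : ∀ j, ∫ p, (τ i j p.1 - (if i = j then (v i : ℝ) else 0))
        * fderiv ℝ D (c • F p.1 + s • p.2) (Pi.single j 1) ∂(P.prod (gpi v))
      = (∫ p, τ i j p.1 * fderiv ℝ D (c • F p.1 + s • p.2) (Pi.single j 1) ∂(P.prod (gpi v)))
        - (if i = j then (v i : ℝ) else 0) * ∫ p, fderiv ℝ D (c • F p.1 + s • p.2) (Pi.single j 1) ∂(P.prod (gpi v)) := by
    intro j
    rw [← integral_const_mul, ← integral_sub (i2 j) ((i1 j).const_mul _)]
    congr 1
    ext p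
    ring
  have e2 : (v i * (s * ∫ p, fderiv ℝ D (c • F p.1 + s • p.2) (Pi.single i 1) ∂(P.prod (gpi v)))) * c
      - (∑ j, c * ∫ p, τ i j p.1 * fderiv ℝ D (c • F p.1 + s • p.2) (Pi.single j 1) ∂(P.prod (gpi v))) * s
      = - (c * ∑ j, s * ∫ p, (τ i j p.1 - (if i = j then (v i : ℝ) else 0))
        * fderiv ℝ D (c • F p.1 + s • p.2) (Pi.single j 1) ∂(P.prod (gpi v))) := by
    simp only [e, mul_sub, Finset.sum_sub_distrib, ← Finset.mul_sum, ite_mul, zero_mul, Finset.sum_ite_eq,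
      Finset.mem_univ, if_true]
    ring
  rw [e2, abs_neg, abs_mul]
  refine (mul_le_of_le_one_left (abs_nonneg _) hc).trans ?_
  refine (Finset.abs_sum_le_sum_abs _ _).trans (Finset.sum_le_sum fun j _ => ?_)
  exact stein_E P v hv F hFm _ ((hτ i j).sub (integrable_const _)) D hD B B' hB hB' c s j

lemma stein_smooth (P : Measure Ω) [IsProbabilityMeasure P] (v : Fin d → ℝ≥0) (hv : ∀ i, v i ≠ 0)
    (F : Ω → Fin d → ℝ) (hFm : Measurable F) (hFi : ∀ i, Integrable (fun ω => F ω i) P)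
    (τ : Fin d → Fin d → Ω → ℝ) (hτ : ∀ i j, Integrable (τ i j) P)
    (hst : ∀ g : (Fin d → ℝ) → ℝ, ContDiff ℝ 1 g → ∀ i, ∫ ω, F ω i * g (F ω) ∂P
      = ∑ j, ∫ ω, τ i j ω * fderiv ℝ g (F ω) (Pi.single j 1) ∂P)
    (h : (Fin d → ℝ) → ℝ) (hh : ContDiff ℝ 2 h) (K K' : ℝ≥0) (hK : LipschitzWith K h)
    (hK' : LipschitzWith K' (fderiv ℝ h)) :
    |(∫ ω, h (F ω) ∂P) - ∫ z, h z ∂(gpi v)|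
      ≤ 2 * ∑ i, ∑ j, K * ((∫ x, |x| ∂(gaussianReal 0 (v j))) / v j)
          * ∫ ω, |τ i j ω - (if i = j then (v i : ℝ) else 0)| ∂P := by
  set M := ∑ i, ∑ j, K * ((∫ x, |x| ∂(gaussianReal 0 (v j))) / v j)
          * ∫ ω, |τ i j ω - (if i = j then (v i : ℝ) else 0)| ∂P with hM
  let D : Fin d → (Fin d → ℝ) → ℝ := fun i x => fderiv ℝ h x (Pi.single i 1)
  have hh1 : Differentiable ℝ h := hh.differentiable (by norm_num)
  have hfd : ContDiff ℝ 1 (fderiv ℝ h) := hh.fderiv_right (by norm_num)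
  have hD : ∀ i, ContDiff ℝ 1 (D i) := fun i => hfd.clm_apply contDiff_const
  have hB : ∀ i x, |D i x| ≤ K := by
    intro i x
    have h1 := (fderiv ℝ h x).le_opNorm (Pi.single i 1)
    have h2 : ‖fderiv ℝ h x‖ ≤ K := norm_fderiv_le_of_lipschitz ℝ hK
    calc |D i x| ≤ ‖fderiv ℝ h x‖ * ‖(Pi.single i (1 : ℝ) : Fin d → ℝ)‖ := h1
      _ ≤ K * 1 := mul_le_mul h2 (norm_single_le i) (norm_nonneg _) K.2
      _ = K := mul_one _
  have hDL : ∀ i, LipschitzWith K' (D i) := by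
    intro i
    apply LipschitzWith.of_dist_le_mul
    intro x y
    have h1 := (fderiv ℝ h x - fderiv ℝ h y).le_opNorm (Pi.single i 1)
    have h2 := hK'.dist_le_mul x y
    rw [dist_eq_norm] at h2
    calc dist (D i x) (D i y) = ‖(fderiv ℝ h x - fderiv ℝ h y) (Pi.single i 1)‖ := by
          rw [dist_eq_norm]; rfl
      _ ≤ ‖fderiv ℝ h x - fderiv ℝ h y‖ * ‖(Pi.single i (1 : ℝ) : Fin d → ℝ)‖ := h1
      _ ≤ (K' * dist x y) * 1 := mul_le_mul h2 (norm_single_le i) (norm_nonneg _) (by positivity)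
      _ = _ := mul_one _
  have hB' : ∀ i j x, |fderiv ℝ (D i) x (Pi.single j 1)| ≤ K' := by
    intro i j x
    have h1 := (fderiv ℝ (D i) x).le_opNorm (Pi.single j 1)
    have h2 : ‖fderiv ℝ (D i) x‖ ≤ K' := norm_fderiv_le_of_lipschitz ℝ (hDL i)
    calc |fderiv ℝ (D i) x (Pi.single j 1)| ≤ ‖fderiv ℝ (D i) x‖ * ‖(Pi.single j (1 : ℝ) : Fin d → ℝ)‖ := h1
      _ ≤ K' * 1 := mul_le_mul h2 (norm_single_le j) (norm_nonneg _) K'.2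
      _ = K' := mul_one _
  let μ := P.prod (gpi v)
  let X : ℝ → Ω × (Fin d → ℝ) → Fin d → ℝ := fun θ p => Real.cos θ • F p.1 + Real.sin θ • p.2
  have hXm : ∀ θ, Measurable (X θ) := fun θ => meas_X F hFm _ _
  let Ψ : ℝ → ℝ := fun θ => ∫ p, h (X θ p) ∂μ
  let G : ℝ → Ω × (Fin d → ℝ) → ℝ := fun θ p =>
    ∑ i, (p.2 i * D i (X θ p) * Real.cos θ - F p.1 i * D i (X θ p) * Real.sin θ)
  have hFi' : ∀ i, Integrable (fun p : Ω × (Fin d → ℝ) => F p.1 i) μ := fun i => (hFi i).comp_fst (gpi v)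
  have hZi : ∀ i, Integrable (fun p : Ω × (Fin d → ℝ) => p.2 i) μ := fun i => (integrable_coord v i).comp_snd P
  have hDm : ∀ i θ, Measurable (fun p => D i (X θ p)) := fun i θ => (hD i).continuous.measurable.comp (hXm θ)
  have hbi : Integrable (fun p : Ω × (Fin d → ℝ) => ∑ i, (K : ℝ) * (|p.2 i| + |F p.1 i|)) μ :=
    integrable_finset_sum _ fun i _ => ((hZi i).abs.add (hFi' i).abs).const_mul _
  have iZ : ∀ i θ, Integrable (fun p => p.2 i * D i (X θ p)) μ := fun i θ =>
    (hZi i).mul_bdd (c := (K : ℝ)) (hDm i θ).aestronglyMeasurable (ae_of_all _ fun _ => hB i _)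
  have iF : ∀ i θ, Integrable (fun p => F p.1 i * D i (X θ p)) μ := fun i θ =>
    (hFi' i).mul_bdd (c := (K : ℝ)) (hDm i θ).aestronglyMeasurable (ae_of_all _ fun _ => hB i _)
  have hGi : ∀ θ, Integrable (G θ) μ := fun θ =>
    integrable_finset_sum _ fun i _ => ((iZ i θ).mul_const _).sub ((iF i θ).mul_const _)
  have hGb : ∀ θ p, ‖G θ p‖ ≤ ∑ i, (K : ℝ) * (|p.2 i| + |F p.1 i|) := by
    intro θ p
    refine (norm_sum_le _ _).trans (Finset.sum_le_sum fun i _ => ?_)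
    rw [mul_add]
    refine (norm_sub_le _ _).trans (add_le_add ?_ ?_)
    · rw [Real.norm_eq_abs, abs_mul, abs_mul, mul_comm |p.2 i|]
      exact (mul_le_of_le_one_right (by positivity) (Real.abs_cos_le_one θ)).trans
        (mul_le_mul_of_nonneg_right (hB _ _) (abs_nonneg _))
    · rw [Real.norm_eq_abs, abs_mul, abs_mul, mul_comm |F p.1 i|]
      exact (mul_le_of_le_one_right (by positivity) (Real.abs_sin_le_one θ)).trans
        (mul_le_mul_of_nonneg_right (hB _ _) (abs_nonneg _))
  have hdiff : ∀ p θ, HasDerivAt (fun θ => h (X θ p)) (G θ p) θ := by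
    intro p θ
    have h1 : HasDerivAt (fun θ => X θ p) ((-Real.sin θ) • F p.1 + Real.cos θ • p.2) θ :=
      ((Real.hasDerivAt_cos θ).smul_const _).add ((Real.hasDerivAt_sin θ).smul_const _)
    have h2 := (hh1 (X θ p)).hasFDerivAt.comp_hasDerivAt θ h1
    refine h2.congr_deriv ?_
    rw [clm_expand]
    refine Finset.sum_congr rfl fun i _ => ?_
    simp only [Pi.add_apply, Pi.smul_apply, smul_eq_mul, D]
    ring
  have hhm : ∀ θ, AEStronglyMeasurable (fun p => h (X θ p)) μ := fun θ =>
    (hh.continuous.measurable.comp (hXm θ)).aestronglyMeasurable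
  have hhb : ∀ x, ‖h x‖ ≤ ∑ i, (K : ℝ) * |x i| + ‖h 0‖ := by
    intro x
    have h1 := hK.norm_sub_le x 0
    rw [sub_zero] at h1
    have h2 : ‖x‖ ≤ ∑ i, |x i| := (pi_norm_le_iff_of_nonneg (Finset.sum_nonneg fun _ _ => abs_nonneg _)).2
      fun i => Finset.single_le_sum (f := fun i => |x i|) (fun _ _ => abs_nonneg _) (Finset.mem_univ i)
    have h3 := norm_le_norm_add_norm_sub' (h x) (h 0)
    rw [← Finset.mul_sum]
    have h4 : (K : ℝ) * ‖x‖ ≤ K * ∑ i, |x i| := mul_le_mul_of_nonneg_left h2 K.2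
    linarith
  have hhi : ∀ θ, Integrable (fun p => h (X θ p)) μ := by
    intro θ
    have hXi : ∀ i, Integrable (fun p => X θ p i) μ := fun i =>
      ((hFi' i).const_mul (Real.cos θ)).add ((hZi i).const_mul (Real.sin θ))
    exact Integrable.mono' ((integrable_finset_sum _ fun i _ => (hXi i).abs.const_mul (K : ℝ)).add
      (integrable_const ‖h 0‖)) (hhm θ) (ae_of_all _ fun p => hhb _)
  have hΨ : ∀ θ, HasDerivAt Ψ (∫ p, G θ p ∂μ) θ := by
    intro θ
    exact (hasDerivAt_integral_of_dominated_loc_of_deriv_le (F := fun θ p => h (X θ p)) (F' := G)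
      (s := Set.univ) Filter.univ_mem (Filter.Eventually.of_forall hhm) (hhi θ) (hGi θ).aestronglyMeasurable
      (ae_of_all _ fun p θ _ => hGb θ p) hbi (ae_of_all _ fun p θ _ => hdiff p θ)).2
  have hbd : ∀ θ, ‖∫ p, G θ p ∂μ‖ ≤ M := by
    intro θ
    have eG : ∫ p, G θ p ∂μ = ∑ i, ∫ p, (p.2 i * D i (X θ p) * Real.cos θ - F p.1 i * D i (X θ p) * Real.sin θ) ∂μ :=
      integral_finset_sum _ fun i _ => ((iZ i θ).mul_const _).sub ((iF i θ).mul_const _)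
    rw [eG, hM]
    refine (norm_sum_le _ _).trans (Finset.sum_le_sum fun i _ => ?_)
    rw [integral_sub ((iZ i θ).mul_const _) ((iF i θ).mul_const _), integral_mul_const, integral_mul_const]
    exact stein_bound P v hv F hFm hFi τ hτ hst (D i) (hD i) K K' (hB i) (hB' i) _ _
      (Real.abs_cos_le_one θ) i
  have hmv := Convex.norm_image_sub_le_of_norm_hasDerivWithin_le (f := Ψ) (s := Set.univ)
    (x := Real.pi / 2) (y := 0)
    (fun θ _ => (hΨ θ).hasDerivWithinAt) (fun θ _ => hbd θ) convex_univ trivial trivial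
  have e0 : Ψ 0 = ∫ ω, h (F ω) ∂P := by
    have : Ψ 0 = ∫ p : Ω × (Fin d → ℝ), h (F p.1) ∂μ := by simp [Ψ, X]
    rw [this]
    have := integral_fun_fst (μ := P) (ν := gpi v) (f := fun ω => h (F ω))
    rw [this]; simp
  have e1 : Ψ (Real.pi / 2) = ∫ z, h z ∂(gpi v) := by
    have : Ψ (Real.pi / 2) = ∫ p : Ω × (Fin d → ℝ), h p.2 ∂μ := by simp [Ψ, X]
    rw [this]
    have := integral_fun_snd (μ := P) (ν := gpi v) (f := fun z => h z)
    rw [this]; simp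
  rw [e0, e1, Real.norm_eq_abs] at hmv
  refine hmv.trans ?_
  have hM0 : 0 ≤ M := (norm_nonneg _).trans (hbd 0)
  have : ‖(0 : ℝ) - Real.pi / 2‖ ≤ 2 := by
    rw [zero_sub, norm_neg, Real.norm_of_nonneg (by positivity)]
    linarith [Real.pi_le_four]
  rw [mul_comm 2]
  exact mul_le_mul_of_nonneg_left this hM0

lemma integrable_lip (P : Measure Ω) [IsProbabilityMeasure P]
    (F : Ω → Fin d → ℝ) (hFm : Measurable F) (hFi : ∀ i, Integrable (fun ω => F ω i) P)
    (h : (Fin d → ℝ) → ℝ) (K : ℝ≥0) (hK : LipschitzWith K h) : Integrable (fun ω => h (F ω)) P := by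
  refine Integrable.mono' ((integrable_finset_sum Finset.univ fun i _ => (hFi i).abs.const_mul (K : ℝ)).add
      (integrable_const ‖h 0‖)) (hK.continuous.measurable.comp hFm).aestronglyMeasurable (ae_of_all _ fun ω => ?_)
  have h1 := hK.norm_sub_le (F ω) 0
  rw [sub_zero] at h1
  have h2 : ‖F ω‖ ≤ ∑ i, |F ω i| := (pi_norm_le_iff_of_nonneg (Finset.sum_nonneg fun _ _ => abs_nonneg _)).2
    fun i => Finset.single_le_sum (f := fun i => |F ω i|) (fun _ _ => abs_nonneg _) (Finset.mem_univ i)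
  have h3 := norm_le_norm_add_norm_sub' (h (F ω)) (h 0)
  simp only [Pi.add_apply]
  rw [← Finset.mul_sum]
  have h4 : (K : ℝ) * ‖F ω‖ ≤ K * ∑ i, |F ω i| := mul_le_mul_of_nonneg_left h2 K.2
  linarith

lemma stein_main (P : Measure Ω) [IsProbabilityMeasure P] (v : Fin d → ℝ≥0) (hv : ∀ i, v i ≠ 0)
    (F : Ω → Fin d → ℝ) (hFm : Measurable F) (hFi : ∀ i, Integrable (fun ω => F ω i) P)
    (τ : Fin d → Fin d → Ω → ℝ) (hτ : ∀ i j, Integrable (τ i j) P)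
    (hst : ∀ g : (Fin d → ℝ) → ℝ, ContDiff ℝ 1 g → ∀ i, ∫ ω, F ω i * g (F ω) ∂P
      = ∑ j, ∫ ω, τ i j ω * fderiv ℝ g (F ω) (Pi.single j 1) ∂P)
    (h : (Fin d → ℝ) → ℝ) (K : ℝ≥0) (hK : LipschitzWith K h) :
    |(∫ ω, h (F ω) ∂P) - ∫ z, h z ∂(gpi v)|
      ≤ 2 * ∑ i, ∑ j, K * ((∫ x, |x| ∂(gaussianReal 0 (v j))) / v j)
          * ∫ ω, |τ i j ω - (if i = j then (v i : ℝ) else 0)| ∂P := by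
  apply le_of_forall_pos_le_add
  intro δ hδ
  obtain ⟨ε, hε, hεδ⟩ : ∃ ε : ℝ, 0 < ε ∧ 2 * (K * ε) ≤ δ := by
    refine ⟨δ / (2 * (K + 1)), by positivity, ?_⟩
    have : (0 : ℝ) ≤ K := K.2
    rw [mul_div_assoc', mul_div_assoc', div_le_iff₀ (by positivity)]
    nlinarith
  obtain ⟨g, hg, hgh, hgK, K', hgK'⟩ := mollify h K hK ε hε
  have key := stein_smooth P v hv F hFm hFi τ hτ hst g hg K K' hgK hgK'
  have comp : ∀ {Ω' : Type _} [MeasurableSpace Ω'] (Q : Measure Ω') [IsProbabilityMeasure Q]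
      (Y : Ω' → Fin d → ℝ), Integrable (fun ω => g (Y ω)) Q → Integrable (fun ω => h (Y ω)) Q →
      |(∫ ω, g (Y ω) ∂Q) - ∫ ω, h (Y ω) ∂Q| ≤ K * ε := by
    intro Ω' _ Q _ Y h1 h2
    rw [← integral_sub h1 h2, ← Real.norm_eq_abs]
    have := norm_integral_le_of_norm_le_const (μ := Q) (f := fun ω => g (Y ω) - h (Y ω)) (C := K * ε)
      (ae_of_all _ fun ω => hgh _)
    simpa using this
  have c1 := comp P F (integrable_lip P F hFm hFi g K hgK) (integrable_lip P F hFm hFi h K hK)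
  have hzi : ∀ f : (Fin d → ℝ) → ℝ, LipschitzWith K f → Integrable (fun z => f z) (gpi v) := fun f hf =>
    integrable_lip (gpi v) (fun z => z) measurable_id (integrable_coord v) f K hf
  have c2 : |(∫ z, g z ∂(gpi v)) - ∫ z, h z ∂(gpi v)| ≤ K * ε := by
    rw [← integral_sub (hzi g hgK) (hzi h hK), ← Real.norm_eq_abs]
    have := norm_integral_le_of_norm_le_const (μ := gpi v) (f := fun ω => g ω - h ω) (C := K * ε)
      (ae_of_all _ fun ω => hgh _)
    simpa using this
  rw [abs_le] at *
  constructor <;> linarith [c1.1, c1.2, c2.1, c2.2, key.1, key.2]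

end
end

/-! ### Part 10: assembly -/

lemma sqrt_sum_le {d : ℕ} (x : Fin d → ℝ) : Real.sqrt (∑ i, (x i) ^ 2) ≤ ∑ i, |x i| := by
  rw [Real.sqrt_le_left (Finset.sum_nonneg fun _ _ => abs_nonneg _)]
  simp only [← sq_abs (x _)]
  exact Finset.sum_sq_le_sq_sum_of_nonneg fun _ _ => abs_nonneg _

/-- rate of convergence in Wasserstein distance: for fixed `k ≥ 3`, there are
constants `C` and `N₀` (depending only on `k`) such that for all `N ≥ N₀` and every function
`f : ℝ^{k−2} → ℝ` that is `1`-Lipschitz with respect to the Euclidean norm,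
`|⟨f(F(M))⟩ − ⟨f(Z)⟩| ≤ C·N^{−1/2}`; i.e. `d_W(F(M), Z) = O(N^{−1/2})`. -/
theorem ume_chebyshev_wasserstein_rate (k : ℕ) (hk : 3 ≤ k) :
    ∃ (C : ℝ) (N₀ : ℕ), ∀ N ≥ N₀,
      ∀ f : (Fin (k - 2) → ℝ) → ℝ,
        (∀ x y, |f x - f y| ≤ Real.sqrt (∑ i, (x i - y i) ^ 2)) →
        |(∫ ω, f (fun i => centeredChebTrace N ((i : ℕ) + 3) ω) ∂(phaseMeasure N))
            - (∫ z, f z ∂(gaussLimit k))|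
          ≤ C / Real.sqrt N := by
  let v : Fin (k - 2) → ℝ≥0 := fun i => (((i : ℕ) : ℝ≥0) + 3) / 4
  have hv : ∀ i, v i ≠ 0 := fun i => by positivity
  let ν : Fin (k - 2) → ℕ := fun i => (i : ℕ) + 3
  have hν : ∀ i, 3 ≤ ν i := fun i => Nat.le_add_left _ _
  haveI : ∀ i, NeZero (ν i) := fun i => ⟨by have := hν i; omega⟩
  have hg : ∀ i j : Fin (k - 2), ∃ C : ℝ, 0 ≤ C ∧ ∀ N, 3 ≤ N →
      ∫ ω, |gam N (ν i) (ν j) ω / ν i - (if i = j then (v i : ℝ) else 0)| ∂(phaseMeasure N) ≤ C / Real.sqrt N := by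
    intro i j
    obtain ⟨C, h0, hC⟩ := gam_rate (ν i) (ν j) (hν i) (hν j)
    refine ⟨C, h0, fun N hN => ?_⟩
    have := hC N hN
    have e : (if ν i = ν j then (ν i : ℝ) / 4 else 0) = (if i = j then (v i : ℝ) else 0) := by
      by_cases h : i = j
      · subst h; simp [ν, v]
      · have : ν i ≠ ν j := fun h' => h (Fin.ext (by simpa [ν] using h'))
        simp [h, this]
    rwa [e] at this
  choose C hC0 hC using hg
  let A : Fin (k - 2) → ℝ := fun j => (∫ x, |x| ∂(ProbabilityTheory.gaussianReal 0 (v j))) / v j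
  have hA : ∀ j, 0 ≤ A j := fun j => div_nonneg (integral_nonneg fun _ => abs_nonneg _) (v j).2
  let K : ℝ≥0 := ((k - 2 : ℕ) : ℝ≥0)
  let R : Fin (k - 2) → ℝ := fun i => Real.sqrt (((ν i - 1) ^ (ν i + ν i) : ℕ) * 3 ^ (ν i))
  refine ⟨∑ i, R i + 2 * ∑ i, ∑ j, K * A j * C i j, 3, ?_⟩
  intro N hN f hf
  have hf' : ∀ x y, |f x - f y| ≤ ∑ i, |x i - y i| := fun x y => (hf x y).trans (sqrt_sum_le fun i => x i - y i)
  have hK : LipschitzWith K f := by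
    apply LipschitzWith.of_dist_le_mul
    intro x y
    rw [Real.dist_eq]
    refine (hf' x y).trans ?_
    have : ∀ i ∈ Finset.univ, |x i - y i| ≤ dist x y := fun i _ => by
      rw [← Real.dist_eq]; exact dist_le_pi_dist x y i
    refine (Finset.sum_le_card_nsmul _ _ _ this).trans (le_of_eq ?_)
    rw [Finset.card_univ, Fintype.card_fin, nsmul_eq_mul, NNReal.coe_natCast]
  have hcont : ∀ i : Fin (k - 2), Continuous (centeredChebTrace N (ν i)) := by
    intro i
    have : centeredChebTrace N (ν i) = fun ω => Ft N (ν i) ω +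
      (1 / (2 * sN N ^ (ν i))) * (gBad (ν i) N ω - ∫ ω', gBad (ν i) N ω' ∂(phaseMeasure N)).re :=
      funext (centered_eq (hν i) hN)
    rw [this]
    exact continuous_Ft.add (continuous_const.mul (Complex.continuous_re.comp (continuous_gBad.sub continuous_const)))
  have hcF : Continuous (fun ω : Fin N → Fin N → ℝ => fun i => centeredChebTrace N (ν i) ω) := continuous_pi hcont
  have hcG : Continuous (fun ω : Fin N → Fin N → ℝ => fun i : Fin (k - 2) => Ft N (ν i) ω) :=
    continuous_pi fun i => continuous_Ft
  have b1 : |(∫ ω, f (fun i => centeredChebTrace N (ν i) ω) ∂(phaseMeasure N))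
      - ∫ ω, f (fun i => Ft N (ν i) ω) ∂(phaseMeasure N)| ≤ (∑ i, R i) / Real.sqrt N := by
    have j1 : Integrable (fun ω => f (fun i => centeredChebTrace N (ν i) ω)) (phaseMeasure N) :=
      integrable_phase _ (hK.continuous.comp hcF)
    have j2 : Integrable (fun ω => f (fun i => Ft N (ν i) ω)) (phaseMeasure N) :=
      integrable_phase _ (hK.continuous.comp hcG)
    rw [← integral_sub j1 j2, ← Real.norm_eq_abs]
    have hi : ∀ i, Integrable (fun ω => |centeredChebTrace N (ν i) ω - Ft N (ν i) ω|) (phaseMeasure N) := fun i =>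
      integrable_phase _ ((hcont i).sub continuous_Ft).abs
    refine (norm_integral_le_of_norm_le (integrable_finsetSum Finset.univ fun i _ => hi i)
      (ae_of_all _ fun ω => hf' _ _)).trans ?_
    rw [integral_finsetSum _ fun i _ => hi i, Finset.sum_div]
    exact Finset.sum_le_sum fun i _ => approx_rate (hν i) hN
  have b2 : |(∫ ω, f (fun i => Ft N (ν i) ω) ∂(phaseMeasure N)) - ∫ z, f z ∂(gpi v)|
      ≤ (2 * ∑ i, ∑ j, K * A j * C i j) / Real.sqrt N := by
    refine (stein_main (phaseMeasure N) v hv (fun ω i => Ft N (ν i) ω) hcG.measurable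
      (fun i => integrable_phase _ continuous_Ft) (fun i j ω => gam N (ν i) (ν j) ω / ν i)
      (fun i j => integrable_phase _ (continuous_gam.div_const _)) (fun g hg i => phase_stein ν hν N g hg i)
      f K hK).trans ?_
    rw [mul_div_assoc]
    simp only [Finset.sum_div]
    refine mul_le_mul_of_nonneg_left (Finset.sum_le_sum fun i _ => Finset.sum_le_sum fun j _ => ?_) (by norm_num)
    rw [mul_div_assoc]
    exact mul_le_mul_of_nonneg_left (hC i j N hN) (mul_nonneg K.2 (hA j))
  rw [add_div]
  exact (abs_sub_le _ _ _).trans (add_le_add b1 b2)
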